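/- arXiv:1401.2249 — 2 statements merged into one kernel-verified Lean document; each statement's English description precedes it below -/
import Mathlib

section
/- Let Ω ⊆ ℂ^n, with n ≥ 2, be a nonempty bounded open set. There exist finitely many functions f_1,…,f_N on Ω̄, each the restriction to Ω̄ of a C^∞ function on ℂ^n ≅ ℝ^{2n}, and a compact set K ⊆ Ω, such that: (1) the graph 𝒢_f(Ω̄) ⊆ ℂ^{n+N} is polynomially convex; (2') every point p ∈ Ω̄ is a peak point for [z,f]_{Ω̄}, i.e., there exists g ∈ [z,f]_{Ω̄} with g(p) = 1 and |g(q)| < 1 for all q ∈ Ω̄ \ {p}; (3) every f ∈ C(Ω̄,ℂ) whose restriction to K lies in R(K) belongs to [z,f]_{Ω̄}; (4) [z,f]_{Ω̄} ≠ C(Ω̄,ℂ). -/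
open Metric

noncomputable def polyHull {m : ℕ} (K : Set (Fin m → ℂ)) : Set (Fin m → ℂ) :=
  {z | ∀ p : MvPolynomial (Fin m) ℂ,
    ‖MvPolynomial.eval z p‖ ≤ sSup ((fun w => ‖MvPolynomial.eval w p‖) '' K)}

noncomputable def genAlg {X : Type*} [TopologicalSpace X] (S : Set C(X, ℂ)) : Set C(X, ℂ) :=
  closure ((Algebra.adjoin ℂ S : Subalgebra ℂ C(X, ℂ)) : Set C(X, ℂ))

/-- Generators of the algebra `[z₁,…,zₙ, f₁,…,f_N]_M`. -/
def zhGens {n N : ℕ} (M : Set (Fin n → ℂ)) (h : Fin N → (Fin n → ℂ) → ℂ) :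
    Set C(M, ℂ) :=
  {g | (∃ i : Fin n, ∀ z : M, g z = (z : Fin n → ℂ) i) ∨
       (∃ j : Fin N, ∀ z : M, g z = h j (z : Fin n → ℂ))}

/-- The graph of `(h₁,…,h_N)` over `E ⊆ ℂⁿ`, inside `ℂ^{n+N}`. -/
def graphSet {n N : ℕ} (h : Fin N → (Fin n → ℂ) → ℂ) (E : Set (Fin n → ℂ)) :
    Set (Fin (n + N) → ℂ) :=
  (fun z => Fin.append z (fun j => h j z)) '' E

/-- `R(K)`: uniform closure on `K ⊆ ℂⁿ` of rational functions `p/q` with `q` zero-free on `K`. -/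
noncomputable def ratAlg {n : ℕ} (K : Set (Fin n → ℂ)) : Set C(K, ℂ) :=
  closure {g : C(K, ℂ) | ∃ p q : MvPolynomial (Fin n) ℂ,
    (∀ z ∈ K, MvPolynomial.eval z q ≠ 0) ∧
    ∀ z : K, g z = MvPolynomial.eval (z : Fin n → ℂ) p / MvPolynomial.eval (z : Fin n → ℂ) q}


open MeasureTheory in
lemma aux_stokes (u : ℂ → ℂ) (hu : ContDiff ℝ 1 u) (hc : HasCompactSupport u) :
    ∫ z, (fderiv ℝ u z 1 + Complex.I * fderiv ℝ u z Complex.I) = 0 ∧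
    Integrable (fun z => fderiv ℝ u z 1 + Complex.I * fderiv ℝ u z Complex.I) := by
  have hcont : Continuous (fderiv ℝ u) := hu.continuous_fderiv (by norm_num)
  have hi : ∀ v : ℂ, Integrable (fun z => fderiv ℝ u z v) := by
    intro v
    refine Continuous.integrable_of_hasCompactSupport (by fun_prop) ?_
    exact hc.fderiv_apply (𝕜 := ℝ) v
  have hui : Integrable u := hu.continuous.integrable_of_hasCompactSupport hc
  have key : ∀ v : ℂ, ∫ z, fderiv ℝ u z v = 0 := by
    intro v
    have := integral_smul_fderiv_eq_neg_fderiv_smul_of_integrable (μ := (volume : Measure ℂ))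
      (f := fun _ : ℂ => (1:ℝ)) (g := u) (v := v) (𝕜 := ℝ) (by simp) (by simpa using hi v) (by simpa using hui)
      (by fun_prop) (fun x _ => (hu.differentiable (by norm_num)) x)
    simpa using this
  refine ⟨?_, (hi 1).add ((hi _).const_mul _)⟩
  rw [integral_add (hi 1) ((hi _).const_mul _), integral_const_mul, key, key]
  simp

open MeasureTheory in
lemma aux_bump : ∃ C : ℝ, 0 < C ∧ ∀ (c : ℂ) (σ : ℝ), 0 < σ → ∃ b : ℂ → ℝ, ContDiff ℝ 1 b ∧
    HasCompactSupport b ∧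
    (∀ z ∈ ball c σ, b z = 1) ∧ (∀ z, 0 ≤ b z ∧ b z ≤ 1) ∧
    ∫ z, ‖fderiv ℝ b z‖ ≤ C * σ ∧ ∫ z, b z ≤ 16 * σ ^ 2 := by
  let b0 : ContDiffBump (0 : ℂ) := ⟨1, 2, by norm_num, by norm_num⟩
  refine ⟨1 + ∫ z, ‖fderiv ℝ b0 z‖, ?_, ?_⟩
  · have : 0 ≤ ∫ z, ‖fderiv ℝ b0 z‖ := integral_nonneg (fun z => norm_nonneg _)
    linarith
  intro c σ hσ
  have hsm : ContDiff ℝ 1 b0 := b0.contDiff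
  refine ⟨fun z => b0 (σ⁻¹ • (z - c)), ?_, ?_, ?_, ?_, ?_, ?_⟩
  · exact hsm.comp (by fun_prop)
  · have := b0.hasCompactSupport.comp_homeomorph
      ((Homeomorph.subRight c).trans (Homeomorph.smulOfNeZero (σ⁻¹ : ℝ) (by positivity)))
    exact this
  · intro z hz
    apply b0.one_of_mem_closedBall
    simp only [mem_closedBall, dist_zero_right, norm_smul, norm_inv, Real.norm_eq_abs, abs_of_pos hσ]
    rw [mem_ball, dist_eq_norm] at hz
    rw [inv_mul_le_iff₀ hσ]
    change _ ≤ σ * 1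
    linarith
  · intro z
    exact ⟨b0.nonneg, b0.le_one⟩
  · have h1 : ∀ z, ‖fderiv ℝ (fun z => b0 (σ⁻¹ • (z - c))) z‖ = σ⁻¹ * ‖fderiv ℝ b0 (σ⁻¹ • (z - c))‖ := by
      intro z
      have h2 : HasFDerivAt (fun z : ℂ => σ⁻¹ • (z - c)) (σ⁻¹ • ContinuousLinearMap.id ℝ ℂ) z :=
        ((hasFDerivAt_id z).sub_const c).fun_const_smul _
      have h3 := ((hsm.differentiable (by norm_num)) (σ⁻¹ • (z - c))).hasFDerivAt.comp z h2
      have h4 := h3.fderiv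
      change fderiv ℝ (fun z => b0 (σ⁻¹ • (z - c))) z = _ at h4
      rw [h4]
      simp [norm_smul, abs_of_pos hσ]
    simp_rw [h1]
    rw [integral_const_mul, integral_sub_right_eq_self (fun z : ℂ => ‖fderiv ℝ b0 (σ⁻¹ • z)‖) c,
      Measure.integral_comp_inv_smul volume (fun z : ℂ => ‖fderiv ℝ b0 z‖) σ]
    simp only [Complex.finrank_real_complex, smul_eq_mul, abs_of_pos (pow_pos hσ 2)]
    have : σ⁻¹ * (σ ^ 2 * ∫ z, ‖fderiv ℝ b0 z‖) = (∫ z, ‖fderiv ℝ b0 z‖) * σ := by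
      field_simp
    rw [this]
    nlinarith
  · rw [integral_sub_right_eq_self (fun z : ℂ => b0 (σ⁻¹ • z)) c,
      Measure.integral_comp_inv_smul volume (fun z : ℂ => b0 z) σ]
    simp only [Complex.finrank_real_complex, smul_eq_mul, abs_of_pos (pow_pos hσ 2)]
    have h := b0.integral_le_measure_closedBall (μ := volume)
    have h2 : (volume : Measure ℂ).real (closedBall 0 b0.rOut) = 4 * Real.pi := by
      rw [Measure.real, Complex.volume_closedBall]
      change (ENNReal.ofReal 2 ^ 2 * _).toReal = _
      simp; norm_num
    rw [h2] at h
    nlinarith [Real.pi_lt_four, sq_nonneg σ]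

open MeasureTheory in
lemma aux_cut : ∃ C : ℝ, 0 < C ∧ ∀ L : List (ℂ × ℝ), (∀ x ∈ L, 0 < x.2) → ∃ χ : ℂ → ℝ,
    ContDiff ℝ 1 χ ∧ (∀ z, 1/2 < ‖z‖ → χ z = 0) ∧ (∀ x ∈ L, ∀ z ∈ ball x.1 x.2, χ z = 0) ∧
    (∀ z, 0 ≤ χ z ∧ χ z ≤ 1) ∧ ∫ z, ‖fderiv ℝ χ z‖ ≤ C * (1 + (L.map Prod.snd).sum) ∧
    1/8 - 16 * (L.map (fun x => x.2 ^ 2)).sum ≤ ∫ z, χ z := by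
  obtain ⟨C, hC, hb⟩ := aux_bump
  let b0 : ContDiffBump (0 : ℂ) := ⟨1/4, 1/2, by norm_num, by norm_num⟩
  have hI : 0 ≤ ∫ z, ‖fderiv ℝ b0 z‖ := integral_nonneg (fun z => norm_nonneg _)
  refine ⟨C + ∫ z, ‖fderiv ℝ b0 z‖, by linarith, ?_⟩
  intro L
  induction L with
  | nil =>
    intro _
    refine ⟨b0, b0.contDiff, ?_, by simp, fun z => ⟨b0.nonneg, b0.le_one⟩, ?_, ?_⟩
    · intro z hz
      apply b0.zero_of_le_dist
      rw [dist_zero_right]; exact hz.le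
    · simp; linarith
    · have h := b0.measure_closedBall_le_integral (μ := volume)
      have h2 : (volume : Measure ℂ).real (closedBall 0 b0.rIn) = Real.pi / 16 := by
        rw [Measure.real, Complex.volume_closedBall]
        change (ENNReal.ofReal (1/4) ^ 2 * _).toReal = _
        simp; ring
      rw [h2] at h
      simp
      linarith [Real.pi_gt_three]
  | cons x L ih =>
    intro hL
    obtain ⟨χ, h1, h2, h3, h4, h5, h6⟩ := ih (fun y hy => hL y (by simp [hy]))
    have hx : 0 < x.2 := hL x (by simp)
    obtain ⟨b, g1, g2, g3, g4, g5, g6⟩ := hb x.1 x.2 hx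
    have hχc : HasCompactSupport χ := by
      apply HasCompactSupport.intro (isCompact_closedBall (0:ℂ) (1/2))
      intro z hz
      apply h2
      simpa using hz
    have d1 : Differentiable ℝ χ := h1.differentiable (by norm_num)
    have d2 : Differentiable ℝ b := g1.differentiable (by norm_num)
    have c1 : Continuous (fderiv ℝ χ) := h1.continuous_fderiv (by norm_num)
    have c2 : Continuous (fderiv ℝ b) := g1.continuous_fderiv (by norm_num)
    have i1 : Integrable (fun z => ‖fderiv ℝ χ z‖) :=
      (c1.integrable_of_hasCompactSupport (hχc.fderiv (𝕜 := ℝ))).norm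
    have i2 : Integrable (fun z => ‖fderiv ℝ b z‖) :=
      (c2.integrable_of_hasCompactSupport (g2.fderiv (𝕜 := ℝ))).norm
    have i3 : Integrable χ := h1.continuous.integrable_of_hasCompactSupport hχc
    have i4 : Integrable b := g1.continuous.integrable_of_hasCompactSupport g2
    have sm : ContDiff ℝ 1 (fun z => χ z * (1 - b z)) := h1.mul (contDiff_const.sub g1)
    have cs : HasCompactSupport (fun z => χ z * (1 - b z)) := hχc.mul_right
    refine ⟨fun z => χ z * (1 - b z), sm, ?_, ?_, ?_, ?_, ?_⟩
    · intro z hz; simp [h2 z hz]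
    · intro y hy z hz
      rcases List.mem_cons.1 hy with rfl | hy
      · simp [g3 z hz]
      · simp [h3 y hy z hz]
    · intro z
      obtain ⟨p1, p2⟩ := h4 z
      obtain ⟨q1, q2⟩ := g4 z
      constructor
      · nlinarith
      · nlinarith
    · have hp : ∀ z, ‖fderiv ℝ (fun z => χ z * (1 - b z)) z‖ ≤ ‖fderiv ℝ χ z‖ + ‖fderiv ℝ b z‖ := by
        intro z
        have := ((d1 z).hasFDerivAt.mul ((d2 z).hasFDerivAt.const_sub 1)).fderiv
        change fderiv ℝ (fun z => χ z * (1 - b z)) z = _ at this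
        rw [this]
        obtain ⟨p1, p2⟩ := h4 z
        obtain ⟨q1, q2⟩ := g4 z
        refine (norm_add_le _ _).trans ?_
        rw [norm_smul, norm_smul, norm_neg, Real.norm_eq_abs, Real.norm_eq_abs, abs_of_nonneg p1,
          abs_of_nonneg (by linarith : 0 ≤ 1 - b z)]
        nlinarith [norm_nonneg (fderiv ℝ χ z), norm_nonneg (fderiv ℝ b z)]
      have hle : ∫ z, ‖fderiv ℝ (fun z => χ z * (1 - b z)) z‖ ≤ ∫ z, (‖fderiv ℝ χ z‖ + ‖fderiv ℝ b z‖) := by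
        apply integral_mono_of_nonneg (Filter.Eventually.of_forall fun z => norm_nonneg _) (i1.add i2)
        exact Filter.Eventually.of_forall hp
      rw [integral_add i1 i2] at hle
      simp only [List.map_cons, List.sum_cons]
      nlinarith
    · have hle : ∫ z, (χ z - b z) ≤ ∫ z, χ z * (1 - b z) := by
        apply integral_mono (i3.sub i4) (sm.continuous.integrable_of_hasCompactSupport cs)
        intro z
        obtain ⟨p1, p2⟩ := h4 z
        obtain ⟨q1, q2⟩ := g4 z
        change χ z - b z ≤ χ z * (1 - b z)
        nlinarith
      rw [integral_sub i3 i4] at hle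
      simp only [List.map_cons, List.sum_cons]
      linarith

lemma aux_adjoin_analytic (P : ℕ → Polynomial ℂ) (g : ℂ → ℂ)
    (hg : g ∈ Algebra.adjoin ℂ ({id} ∪ Set.range (fun k => fun z : ℂ => ((P k).eval z)⁻¹))) :
    ∃ N : ℕ, ∀ z, (∀ k < N, (P k).eval z ≠ 0) → AnalyticAt ℂ g z := by
  induction hg using Algebra.adjoin_induction with
  | mem x hx =>
    rcases hx with hx | ⟨k, rfl⟩
    · rw [Set.mem_singleton_iff] at hx
      subst hx
      exact ⟨0, fun z _ => analyticAt_id⟩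
    · refine ⟨k + 1, fun z hz => ?_⟩
      refine AnalyticAt.inv ?_ (hz k (by omega))
      exact (P k).differentiable.analyticAt z
  | algebraMap r => exact ⟨0, fun z _ => analyticAt_const⟩
  | add x y _ _ hx hy =>
    obtain ⟨N, hN⟩ := hx
    obtain ⟨M, hM⟩ := hy
    exact ⟨max N M, fun z hz => (hN z fun k hk => hz k (by omega)).add
      (hM z fun k hk => hz k (by omega))⟩
  | mul x y _ _ hx hy =>
    obtain ⟨N, hN⟩ := hx
    obtain ⟨M, hM⟩ := hy
    exact ⟨max N M, fun z hz => (hN z fun k hk => hz k (by omega)).mul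
      (hM z fun k hk => hz k (by omega))⟩

open MeasureTheory in
lemma aux_nondense (P : ℕ → Polynomial ℂ) (s : ℕ → ℝ) (L : ℕ → List (ℂ × ℝ))
    (pos : ∀ k, ∀ x ∈ L k, 0 < x.2) (hs : ∀ k, 0 < s k)
    (hcov : ∀ k z, ‖(P k).eval z‖ < s k → ∃ x ∈ L k, z ∈ ball x.1 x.2)
    (B : ℝ) (S1 : ∀ M : ℕ, (((List.range M).flatMap L).map Prod.snd).sum ≤ B)
    (S2 : ∀ M : ℕ, (((List.range M).flatMap L).map (fun x => x.2 ^ 2)).sum ≤ 1/200) :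
    ∃ ε > 0, ∀ g ∈ Algebra.adjoin ℂ ({id} ∪ Set.range (fun k => fun z : ℂ => ((P k).eval z)⁻¹)),
      ∃ z : ℂ, ‖z‖ ≤ 1/2 ∧ (∀ k, s k ≤ ‖(P k).eval z‖) ∧ ε ≤ ‖(starRingEnd ℂ) z - g z‖ := by
  obtain ⟨C, hC, hcut⟩ := aux_cut
  have hB : 0 ≤ B := by simpa using S1 0
  refine ⟨1 / (100 * (C * (1 + B))), by positivity, ?_⟩
  set ε := 1 / (100 * (C * (1 + B))) with hε
  have hε0 : 0 < ε := by positivity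
  intro g hg
  by_contra! hcon
  obtain ⟨N, hN⟩ := aux_adjoin_analytic P g hg
  let EM : ℕ → Set ℂ := fun M => {z | ‖z‖ ≤ 1/2 ∧ ∀ k < M, s k ≤ ‖(P k).eval z‖}
  have hEc : ∀ M, IsClosed (EM M) := by
    intro M
    have : EM M = {z | ‖z‖ ≤ 1/2} ∩ ⋂ k, ⋂ (_ : k < M), {z | s k ≤ ‖(P k).eval z‖} := by
      ext z; simp [EM]
    rw [this]
    refine (isClosed_le (by fun_prop) (by fun_prop)).inter ?_
    exact isClosed_iInter fun k => isClosed_iInter fun _ => isClosed_le (by fun_prop) (by fun_prop)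
  have hnz : ∀ M, ∀ z ∈ EM M, ∀ k < M, (P k).eval z ≠ 0 := by
    intro M z hz k hk h0
    have := hz.2 k hk
    rw [h0, norm_zero] at this
    linarith [hs k]
  have hM : ∃ M, ∀ z ∈ EM (N + M), ‖(starRingEnd ℂ) z - g z‖ < ε := by
    by_contra! hno
    let T : ℕ → Set ℂ := fun M => EM (N + M) ∩ (fun z => ‖(starRingEnd ℂ) z - g z‖) ⁻¹' (Set.Ici ε)
    have hTc : ∀ M, IsClosed (T M) := by
      intro M
      refine ContinuousOn.preimage_isClosed_of_isClosed ?_ (hEc _) isClosed_Ici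
      intro z hz
      have : ContinuousAt g z := (hN z fun k hk => hnz _ z hz k (by omega)).continuousAt
      refine ContinuousAt.continuousWithinAt ?_
      exact ((Complex.continuous_conj.continuousAt).sub this).norm
    have hT0 : IsCompact (T 0) := by
      refine (isCompact_closedBall (0:ℂ) (1/2)).of_isClosed_subset (hTc 0) ?_
      intro z hz
      simpa using hz.1.1
    obtain ⟨z, hz⟩ := IsCompact.nonempty_iInter_of_sequence_nonempty_isCompact_isClosed T
      (by
        intro i z hz
        exact ⟨⟨hz.1.1, fun k hk => hz.1.2 k (by omega)⟩, hz.2⟩)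
      (by
        intro i
        obtain ⟨z, hz, hz2⟩ := hno i
        exact ⟨z, hz, hz2⟩) hT0 hTc
    rw [Set.mem_iInter] at hz
    have h1 := hcon z (hz 0).1.1 (fun k => (hz (k+1)).1.2 k (by omega))
    have h2 : ε ≤ ‖(starRingEnd ℂ) z - g z‖ := (hz 0).2
    linarith
  obtain ⟨M', hM'⟩ := hM
  set M := N + M' with hMdef
  obtain ⟨χ, h1, h2, h3, h4, h5, h6⟩ := hcut ((List.range M).flatMap L) (by
    intro x hx
    rw [List.mem_flatMap] at hx
    obtain ⟨k, _, hk⟩ := hx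
    exact pos k x hk)
  have hχd : Differentiable ℝ χ := h1.differentiable (by norm_num)
  have hχcs : HasCompactSupport χ := by
    apply HasCompactSupport.intro (isCompact_closedBall (0:ℂ) (1/2))
    intro z hz
    apply h2
    simpa using hz
  have hloc : ∀ z, z ∉ EM M → χ =ᶠ[nhds z] 0 := by
    intro z hz
    by_cases hz1 : ‖z‖ ≤ 1/2
    · have : ∃ k < M, ‖(P k).eval z‖ < s k := by
        by_contra! hh
        exact hz ⟨hz1, hh⟩
      obtain ⟨k, hk, hk2⟩ := this
      obtain ⟨x, hx, hx2⟩ := hcov k z hk2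
      filter_upwards [isOpen_ball.mem_nhds hx2] with y hy
      exact h3 x (List.mem_flatMap.2 ⟨k, List.mem_range.2 hk, hx⟩) y hy
    · have ho : IsOpen {z : ℂ | 1/2 < ‖z‖} := isOpen_lt (by fun_prop) (by fun_prop)
      filter_upwards [ho.mem_nhds (not_le.1 hz1)] with y hy
      exact h2 y hy
  let χc : ℂ → ℂ := fun z => (χ z : ℂ)
  have hχc1 : ContDiff ℝ 1 χc := Complex.ofRealCLM.contDiff.comp h1
  have hχcd : ∀ z, HasFDerivAt χc (Complex.ofRealCLM.comp (fderiv ℝ χ z)) z := fun z =>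
    Complex.ofRealCLM.hasFDerivAt.comp z (hχd z).hasFDerivAt
  let u : ℂ → ℂ := fun z => ((starRingEnd ℂ) z - g z) * χc z
  have hloc2 : ∀ z, z ∉ EM M → u =ᶠ[nhds z] 0 := by
    intro z hz
    filter_upwards [hloc z hz] with y hy
    simp [u, χc, hy]
  have hgan : ∀ z ∈ EM M, AnalyticAt ℂ g z := fun z hz => hN z fun k hk => hnz _ z hz k (by omega)
  have hu : ContDiff ℝ 1 u := by
    rw [contDiff_iff_contDiffAt]
    intro z
    by_cases hz : z ∈ EM M
    · refine ContDiffAt.mul (ContDiffAt.sub ?_ ?_) hχc1.contDiffAt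
      · exact Complex.conjCLE.contDiff.contDiffAt
      · exact ((hgan z hz).contDiffAt (n := 1)).restrict_scalars ℝ
    · exact (contDiffAt_const (c := (0:ℂ))).congr_of_eventuallyEq (hloc2 z hz)
  have hcs : HasCompactSupport u := by
    apply HasCompactSupport.intro (isCompact_closedBall (0:ℂ) (1/2))
    intro z hz
    have : χ z = 0 := by
      apply h2
      simpa using hz
    simp [u, χc, this]
  obtain ⟨st, sti⟩ := aux_stokes u hu hcs
  set D : ℂ → ℂ := fun z => fderiv ℝ u z 1 + Complex.I * fderiv ℝ u z Complex.I with hD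
  have hbound : ∀ z, ‖D z - 2 * χc z‖ ≤ 2 * ε * ‖fderiv ℝ χ z‖ := by
    intro z
    by_cases hz : z ∈ EM M
    · have e1 : HasFDerivAt (fun z => (starRingEnd ℂ) z) (Complex.conjCLE : ℂ →L[ℝ] ℂ) z :=
        Complex.conjCLE.hasFDerivAt
      have e2 : HasFDerivAt g ((fderiv ℂ g z).restrictScalars ℝ) z :=
        (hgan z hz).differentiableAt.hasFDerivAt.restrictScalars ℝ
      have e3 := ((e1.sub e2).mul (hχcd z)).fderiv
      change fderiv ℝ u z = _ at e3
      have e4 : fderiv ℂ g z Complex.I = Complex.I * deriv g z := by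
        have := (fderiv ℂ g z).map_smul Complex.I 1
        rw [smul_eq_mul, mul_one] at this
        rw [this, fderiv_apply_one_eq_deriv, smul_eq_mul]
      have e5 : D z - 2 * χc z = ((starRingEnd ℂ) z - g z) *
          ((fderiv ℝ χ z 1 : ℝ) + Complex.I * (fderiv ℝ χ z Complex.I : ℝ)) := by
        simp only [hD]
        rw [e3]
        simp [e4]
        linear_combination (-(χc z + χc z * deriv g z)) * Complex.I_sq
      rw [e5, norm_mul]
      have e6 : ‖((fderiv ℝ χ z 1 : ℝ) + Complex.I * (fderiv ℝ χ z Complex.I : ℝ) : ℂ)‖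
          ≤ 2 * ‖fderiv ℝ χ z‖ := by
        refine (norm_add_le _ _).trans ?_
        rw [norm_mul, Complex.norm_I, one_mul, Complex.norm_real, Complex.norm_real]
        have a1 := (fderiv ℝ χ z).le_opNorm 1
        have a2 := (fderiv ℝ χ z).le_opNorm Complex.I
        simp only [norm_one, Complex.norm_I, mul_one] at a1 a2
        linarith
      have e7 := (hM' z hz).le
      calc _ ≤ ε * (2 * ‖fderiv ℝ χ z‖) := by gcongr
        _ = _ := by ring
    · have e1 : fderiv ℝ u z = 0 := by
        rw [(hloc2 z hz).fderiv_eq]; exact fderiv_const_apply _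
      have e2 : χ z = 0 := (hloc z hz).eq_of_nhds
      simp only [hD, e1, χc, e2]
      simp
      positivity
  have i3 : Integrable χ := h1.continuous.integrable_of_hasCompactSupport hχcs
  have i5 : Integrable χc := i3.ofReal
  have i1 : Integrable (fun z => 2 * ε * ‖fderiv ℝ χ z‖) :=
    (((h1.continuous_fderiv (by norm_num)).integrable_of_hasCompactSupport
      (hχcs.fderiv (𝕜 := ℝ))).norm).const_mul _
  have hfin := norm_integral_le_of_norm_le i1 (Filter.Eventually.of_forall hbound)
  rw [integral_sub sti (i5.const_mul 2), st, integral_const_mul, integral_const_mul] at hfin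
  have hint : ∫ z, χc z = ((∫ z, χ z : ℝ) : ℂ) := integral_ofReal
  rw [hint, zero_sub, norm_neg, norm_mul, Complex.norm_real] at hfin
  have hge : 1/8 - 16 * (1/200 : ℝ) ≤ ∫ z, χ z := by
    have := S2 M
    linarith
  have hle : ∫ z, ‖fderiv ℝ χ z‖ ≤ C * (1 + B) := by
    refine h5.trans ?_
    have := S1 M
    gcongr
  have hle2 : 2 * ε * ∫ z, ‖fderiv ℝ χ z‖ ≤ 2 * ε * (C * (1 + B)) := by gcongr
  have hee : ε * (C * (1 + B)) = 1 / 100 := by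
    rw [hε]; field_simp
  have h2n : ‖(2:ℂ)‖ = 2 := by simp
  rw [h2n, Real.norm_eq_abs] at hfin
  have := le_abs_self (∫ z, χ z)
  nlinarith

lemma aux_root (m : ℕ) (hm : 0 < m) (τ : ℂ) (s : ℝ) (hs : s ≤ 1/2) (h : ‖τ ^ m - 1‖ < s) :
    ∃ j < m, ‖τ - Complex.exp (2 * Real.pi * Complex.I / m) ^ j‖ < 4 * s / m := by
  have hs0 : 0 < s := (norm_nonneg _).trans_lt h
  have hm' : (m : ℂ) ≠ 0 := by exact_mod_cast hm.ne'
  have hmr : (0:ℝ) < m := by exact_mod_cast hm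
  have hm1 : (1:ℝ) ≤ m := by exact_mod_cast hm
  have hu : τ ^ m ≠ 0 := by
    intro h0
    rw [h0] at h
    simp at h
    linarith
  set v := Complex.exp (Complex.log (τ ^ m) / m) with hv
  have hv0 : v ≠ 0 := Complex.exp_ne_zero _
  have hvm : v ^ m = τ ^ m := by
    rw [hv, ← Complex.exp_nat_mul, mul_div_cancel₀ _ hm', Complex.exp_log hu]
  have h1 : (τ / v) ^ m = 1 := by
    rw [div_pow, hvm, div_self hu]
  haveI : NeZero m := ⟨hm.ne'⟩
  obtain ⟨j, hj, hj2⟩ := (Complex.isPrimitiveRoot_exp m hm.ne').eq_pow_of_pow_eq_one h1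
  refine ⟨j, hj, ?_⟩
  rw [hj2]
  have hnv : ‖τ / v‖ = 1 := by
    have : ‖τ / v‖ ^ m = 1 := by rw [← norm_pow, h1, norm_one]
    exact (pow_eq_one_iff_of_nonneg (norm_nonneg _) hm.ne').1 this
  have e1 : τ - τ / v = (τ / v) * (v - 1) := by field_simp
  rw [e1, norm_mul, hnv, one_mul]
  have hl : ‖Complex.log (τ ^ m)‖ ≤ 3/2 * ‖τ ^ m - 1‖ := by
    have := Complex.norm_log_one_add_half_le_self (z := τ ^ m - 1) (by linarith)
    simpa using this
  have hl2 : ‖Complex.log (τ ^ m) / m‖ ≤ 3/2 * s / m := by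
    rw [norm_div, Complex.norm_natCast]
    gcongr
    linarith
  have hl3 : 3/2 * s / m ≤ 1 := by
    rw [div_le_one hmr]
    nlinarith
  have := Complex.norm_exp_sub_one_le (hl2.trans hl3)
  calc ‖v - 1‖ ≤ 2 * (3/2 * s / m) := this.trans (by gcongr)
    _ = 3 * s / m := by ring
    _ < 4 * s / m := by gcongr; linarith

lemma aux_listsum (L : ℕ → List (ℂ × ℝ)) (F : ℂ × ℝ → ℝ)
    (h : ∀ k, ((L k).map F).sum ≤ 1/400 * (1/2 : ℝ) ^ k) (M : ℕ) :
    (((List.range M).flatMap L).map F).sum ≤ 1/200 * (1 - (1/2 : ℝ) ^ M) := by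
  induction M with
  | zero => simp
  | succ M ih =>
    rw [List.range_succ, List.flatMap_append, List.map_append, List.sum_append]
    have := h M
    simp only [List.flatMap_cons, List.flatMap_nil, List.append_nil]
    rw [pow_succ]
    linarith

lemma aux_params : ∃ (a : ℕ → ℂ) (δ : ℕ → ℝ) (m : ℕ → ℕ), (∀ k, 0 < δ k ∧ δ k ≤ 1) ∧
    (∀ k, 0 < m k) ∧ (∀ k, 1600 * 2 ^ k ≤ (1 + δ k) ^ (m k)) ∧
    ∀ z0 : ℂ, ∀ q > 1, ∃ k, ‖z0 - a k‖ < δ k ∧ (1 + δ k) ^ 2 * (1 + 3 * δ k) ≤ q := by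
  have hex : ∀ k : ℕ, ∃ m : ℕ, 0 < m ∧
      1600 * (2:ℝ) ^ k ≤ (1 + 1 / ((Nat.unpair k).2 + 1 : ℝ)) ^ m := by
    intro k
    obtain ⟨m, hm⟩ := pow_unbounded_of_one_lt (1600 * (2:ℝ) ^ k)
      (show (1:ℝ) < 1 + 1 / ((Nat.unpair k).2 + 1 : ℝ) by
        have : (0:ℝ) < 1 / ((Nat.unpair k).2 + 1 : ℝ) := by positivity
        linarith)
    refine ⟨m, ?_, hm.le⟩
    rcases Nat.eq_zero_or_pos m with rfl | h
    · have : (1:ℝ) ≤ 2 ^ k := one_le_pow₀ (by norm_num)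
      simp at hm
      linarith
    · exact h
  choose m hm1 hm2 using hex
  refine ⟨fun k => TopologicalSpace.denseSeq ℂ (Nat.unpair k).1,
    fun k => 1 / ((Nat.unpair k).2 + 1 : ℝ), m, ?_, hm1, hm2, ?_⟩
  · intro k
    refine ⟨by positivity, ?_⟩
    rw [div_le_one (by positivity)]
    have : (0:ℝ) ≤ (Nat.unpair k).2 := by positivity
    linarith
  · intro z0 q hq
    have ht : Filter.Tendsto (fun l : ℕ => (1 + 1 / ((l:ℝ) + 1)) ^ 2 * (1 + 3 * (1 / ((l:ℝ) + 1))))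
        Filter.atTop (nhds ((1 + 0) ^ 2 * (1 + 3 * 0))) := by
      have := tendsto_one_div_add_atTop_nhds_zero_nat (𝕜 := ℝ)
      exact ((this.const_add 1).pow 2).mul ((this.const_mul 3).const_add 1)
    have hev := ht.eventually (gt_mem_nhds (show ((1:ℝ) + 0) ^ 2 * (1 + 3 * 0) < q by simpa using hq))
    obtain ⟨l, hl⟩ := hev.exists
    have hd := TopologicalSpace.denseRange_denseSeq ℂ
    obtain ⟨i, hi⟩ := hd.exists_dist_lt z0 (show (0:ℝ) < 1 / ((l:ℝ) + 1) by positivity)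
    refine ⟨Nat.pair i l, ?_⟩
    simp only [Nat.unpair_pair]
    rw [dist_eq_norm] at hi
    exact ⟨hi, hl.le⟩

lemma aux_cheese : ∃ (P : ℕ → Polynomial ℂ) (s : ℕ → ℝ), (∀ k, 0 < s k) ∧
    (∀ k z, ‖z‖ ≤ 1/2 → ‖(P k).eval z‖ ≤ 1) ∧
    (∀ z0 : ℂ, ‖z0‖ ≤ 1/2 → ∀ q > 1, ∃ k m : ℕ, 0 < m ∧ ∀ z : ℂ, ‖z‖ ≤ 1/2 →
      s k ≤ ‖(P k).eval z‖ →
      (1 - ‖z0‖ ^ 2) ^ m * ‖(P k).eval z0‖ ≤ 1/2 * q ^ m * ((1 - ‖z‖ ^ 2) ^ m * ‖(P k).eval z‖)) ∧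
    ∃ ε > 0, ∀ g ∈ Algebra.adjoin ℂ ({id} ∪ Set.range (fun k => fun z : ℂ => ((P k).eval z)⁻¹)),
      ∃ z : ℂ, ‖z‖ ≤ 1/2 ∧ (∀ k, s k ≤ ‖(P k).eval z‖) ∧ ε ≤ ‖(starRingEnd ℂ) z - g z‖ := by
  obtain ⟨a, δ, m, hδ, hm, hbig, hnet⟩ := aux_params
  let s : ℕ → ℝ := fun k => ((1 + δ k) ^ (m k))⁻¹
  have hpos : ∀ k, 0 < (1 + δ k) ^ (m k) := fun k => by
    have := (hδ k).1
    positivity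
  have hs0 : ∀ k, 0 < s k := fun k => inv_pos.2 (hpos k)
  have hs1 : ∀ k, s k ≤ 1/1600 * (1/2) ^ k := by
    intro k
    have := inv_anti₀ (by positivity) (hbig k)
    calc s k ≤ _ := this
      _ = _ := by rw [mul_inv, one_div_pow]; norm_num
  have hs2 : ∀ k, s k ≤ 1/1600 := by
    intro k
    have h1 : ((1:ℝ)/2) ^ k ≤ 1 := pow_le_one₀ (by norm_num) (by norm_num)
    have := hs1 k
    linarith
  let M : ℕ → ℝ := fun k => ((1/2 + ‖a k‖) / δ k) ^ (m k) + 1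
  have hM : ∀ k, 0 < M k := fun k => by
    have := (hδ k).1
    positivity
  let P : ℕ → Polynomial ℂ := fun k => Polynomial.C ((M k : ℂ)⁻¹) *
    ((Polynomial.C ((δ k : ℂ)⁻¹) * (Polynomial.X - Polynomial.C (a k))) ^ (m k) - 1)
  have hP : ∀ k z, ‖(P k).eval z‖ = (M k)⁻¹ * ‖((z - a k) / δ k) ^ (m k) - 1‖ := by
    intro k z
    have e : (P k).eval z = (M k : ℂ)⁻¹ * (((z - a k) / δ k) ^ (m k) - 1) := by
      simp only [P, Polynomial.eval_mul, Polynomial.eval_C, Polynomial.eval_sub,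
        Polynomial.eval_pow, Polynomial.eval_X, Polynomial.eval_one]
      rw [div_eq_inv_mul]
    rw [e, norm_mul, norm_inv, Complex.norm_real, Real.norm_eq_abs, abs_of_pos (hM k)]
  have hτ : ∀ k (z : ℂ), ‖(z - a k) / (δ k : ℂ)‖ = ‖z - a k‖ / δ k := by
    intro k z
    rw [norm_div, Complex.norm_real, Real.norm_eq_abs, abs_of_pos (hδ k).1]
  let L : ℕ → List (ℂ × ℝ) := fun k => (List.range (m k)).map (fun j =>
    (a k + δ k * Complex.exp (2 * Real.pi * Complex.I / (m k)) ^ j, 4 * s k * δ k / m k))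
  have hσ : ∀ k, 0 < 4 * s k * δ k / m k := by
    intro k
    have h1 := hs0 k
    have h2 := (hδ k).1
    have h3 : (0:ℝ) < m k := by exact_mod_cast hm k
    positivity
  have hσ1 : ∀ k, 4 * s k * δ k / m k ≤ 1 := by
    intro k
    have h1 := hs0 k
    have h2 := hδ k
    have h3 : (1:ℝ) ≤ m k := by exact_mod_cast hm k
    rw [div_le_one (by linarith)]
    have := hs2 k
    nlinarith
  have hsum1 : ∀ k, ((L k).map Prod.snd).sum ≤ 1/400 * (1/2 : ℝ) ^ k := by
    intro k
    simp only [L, List.map_map, Function.comp_def]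
    rw [List.map_const', List.sum_replicate, List.length_range, nsmul_eq_mul]
    have h3 : (m k : ℝ) ≠ 0 := by exact_mod_cast (hm k).ne'
    rw [mul_div_cancel₀ _ h3]
    have h1 := hs1 k
    have h2 := hδ k
    have h4 := hs0 k
    nlinarith
  have hsum2 : ∀ k, ((L k).map (fun x => x.2 ^ 2)).sum ≤ 1/400 * (1/2 : ℝ) ^ k := by
    intro k
    refine le_trans (List.sum_le_sum ?_) (hsum1 k)
    intro x hx
    simp only [L, List.mem_map] at hx
    obtain ⟨j, _, rfl⟩ := hx
    have h1 := hσ k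
    have h2 := hσ1 k
    simp only
    nlinarith
  refine ⟨P, fun k => (M k)⁻¹ * s k, ?_, ?_, ?_, ?_⟩
  · intro k
    exact mul_pos (inv_pos.2 (hM k)) (hs0 k)
  · intro k z hz
    rw [hP, inv_mul_le_iff₀ (hM k), mul_one]
    refine (norm_sub_le _ _).trans ?_
    rw [norm_pow, hτ, norm_one]
    have h2 := (hδ k).1
    have := norm_sub_le z (a k)
    simp only [M]
    gcongr
    linarith
  · intro z0 hz0 q hq
    obtain ⟨k, hk1, hk2⟩ := hnet z0 q hq
    refine ⟨k, m k, hm k, ?_⟩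
    intro z hz hsz
    rw [hP] at hsz
    rw [hP, hP]
    have hM' := inv_pos.2 (hM k)
    have hsz := le_of_mul_le_mul_left hsz hM'
    have hd := (hδ k).1
    set t := max 1 (‖z - a k‖ / δ k) with ht
    have ht1 : 1 ≤ t := le_max_left _ _
    have ht2 : ‖z - a k‖ ≤ t * δ k := by
      rw [← div_le_iff₀ hd]; exact le_max_right _ _
    -- lower bound
    have hlow : s k / 2 * t ^ (m k) ≤ ‖((z - a k) / δ k) ^ (m k) - 1‖ := by
      have hs2 := hs2 k
      have hs0 := hs0 k
      have htm : t ^ (m k) ≤ max 1 ((‖z - a k‖ / δ k) ^ (m k)) := by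
        rcases le_total 1 (‖z - a k‖ / δ k) with h | h
        · rw [ht, max_eq_right h]; exact le_max_right _ _
        · rw [ht, max_eq_left h]; simp
      have hn : ‖((z - a k) / δ k) ^ (m k)‖ = (‖z - a k‖ / δ k) ^ (m k) := by rw [norm_pow, hτ]
      set y := (‖z - a k‖ / δ k) ^ (m k)
      have hy := norm_sub_norm_le (((z - a k) / δ k) ^ (m k)) 1
      rw [hn, norm_one] at hy
      rcases le_total y 2 with h | h
      · have : max 1 y ≤ 2 := max_le (by norm_num) h
        nlinarith
      · have : max 1 y = y := max_eq_right (by linarith)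
        rw [this] at htm
        nlinarith
    have hup : ‖((z0 - a k) / δ k) ^ (m k) - 1‖ ≤ 2 := by
      refine (norm_sub_le _ _).trans ?_
      rw [norm_pow, hτ, norm_one]
      have : (‖z0 - a k‖ / δ k) ^ (m k) ≤ 1 := by
        apply pow_le_one₀ (by positivity)
        rw [div_le_one hd]; exact hk1.le
      linarith
    have hr : 3/4 ≤ 1 - ‖z‖ ^ 2 := by nlinarith [norm_nonneg z]
    have hr0 : 0 ≤ 1 - ‖z0‖ ^ 2 := by nlinarith [norm_nonneg z0]
    have hcmp : 1 - ‖z0‖ ^ 2 ≤ (1 - ‖z‖ ^ 2) * ((1 + 3 * δ k) * t) := by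
      have h1 : ‖z‖ - ‖z0‖ ≤ ‖z - a k‖ + ‖z0 - a k‖ := by
        have := norm_sub_norm_le z z0
        have h2 : ‖z - z0‖ ≤ ‖z - a k‖ + ‖z0 - a k‖ := by
          have e : z - z0 = (z - a k) - (z0 - a k) := by ring
          rw [e]; exact norm_sub_le _ _
        linarith
      have h2 : ‖z‖ - ‖z0‖ ≤ 2 * (t * δ k) := by nlinarith
      have h3 : ‖z‖ ^ 2 - ‖z0‖ ^ 2 ≤ 2 * (t * δ k) := by
        have e : ‖z‖ ^ 2 - ‖z0‖ ^ 2 = (‖z‖ - ‖z0‖) * (‖z‖ + ‖z0‖) := by ring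
        rw [e]
        have h5 : 0 ≤ ‖z‖ + ‖z0‖ := by positivity
        have h6 : ‖z‖ + ‖z0‖ ≤ 1 := by linarith
        have h7 : 0 ≤ t * δ k := by positivity
        nlinarith
      have h7 : 0 ≤ t * δ k := by positivity
      nlinarith
    have hpow : (1 - ‖z0‖ ^ 2) ^ (m k) ≤
        (1 - ‖z‖ ^ 2) ^ (m k) * ((1 + 3 * δ k) ^ (m k) * t ^ (m k)) := by
      rw [← mul_pow, ← mul_pow]
      exact pow_le_pow_left₀ hr0 hcmp _
    have hq : 8 / s k * (1 + 3 * δ k) ^ (m k) ≤ q ^ (m k) := by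
      have h8 : 8 ≤ (1 + δ k) ^ (m k) := by
        have h1 : (1:ℝ) ≤ 2 ^ k := one_le_pow₀ (by norm_num)
        have := hbig k
        linarith
      calc 8 / s k * (1 + 3 * δ k) ^ (m k)
          = 8 * (1 + δ k) ^ (m k) * (1 + 3 * δ k) ^ (m k) := by
            simp only [s]; rw [div_inv_eq_mul]
        _ ≤ (1 + δ k) ^ (m k) * (1 + δ k) ^ (m k) * (1 + 3 * δ k) ^ (m k) := by gcongr
        _ = ((1 + δ k) ^ 2 * (1 + 3 * δ k)) ^ (m k) := by rw [mul_pow, ← pow_mul, mul_comm 2, pow_mul]; ring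
        _ ≤ q ^ (m k) := by gcongr
    have hR : 0 ≤ (1 - ‖z‖ ^ 2) ^ (m k) := by positivity
    set N1 := ‖((z - a k) / δ k) ^ (m k) - 1‖
    set N0 := ‖((z0 - a k) / δ k) ^ (m k) - 1‖
    set R := (1 - ‖z‖ ^ 2) ^ (m k)
    have hsk := hs0 k
    have hlow' : t ^ (m k) ≤ 2 / s k * N1 := by
      rw [div_mul_eq_mul_div, le_div_iff₀ hsk]
      linarith
    have hN1 : 0 ≤ N1 := norm_nonneg _
    have hfin : (1 - ‖z0‖ ^ 2) ^ (m k) * N0 ≤ 1/2 * q ^ (m k) * (R * N1) := by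
      calc (1 - ‖z0‖ ^ 2) ^ (m k) * N0
          ≤ (R * ((1 + 3 * δ k) ^ (m k) * t ^ (m k))) * 2 := by gcongr
        _ ≤ (R * ((1 + 3 * δ k) ^ (m k) * (2 / s k * N1))) * 2 := by gcongr
        _ = 1/2 * (8 / s k * (1 + 3 * δ k) ^ (m k)) * (R * N1) := by ring
        _ ≤ _ := by gcongr
    calc _ = (M k)⁻¹ * ((1 - ‖z0‖ ^ 2) ^ (m k) * N0) := by ring
      _ ≤ (M k)⁻¹ * (1/2 * q ^ (m k) * (R * N1)) := by gcongr
      _ = _ := by ring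
  · refine aux_nondense P (fun k => (M k)⁻¹ * s k) L ?_ ?_ ?_ (1/200) ?_ ?_
    · intro k x hx
      simp only [L, List.mem_map] at hx
      obtain ⟨j, _, rfl⟩ := hx
      exact hσ k
    · intro k
      exact mul_pos (inv_pos.2 (hM k)) (hs0 k)
    · intro k z hz
      rw [hP] at hz
      have hz := lt_of_mul_lt_mul_left hz (inv_pos.2 (hM k)).le
      obtain ⟨j, hj, hj2⟩ := aux_root (m k) (hm k) _ (s k) (by linarith [hs2 k]) hz
      refine ⟨_, List.mem_map.2 ⟨j, List.mem_range.2 hj, rfl⟩, ?_⟩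
      simp only [mem_ball, dist_eq_norm]
      have hd := (hδ k).1
      have hdc : (δ k : ℂ) ≠ 0 := by exact_mod_cast hd.ne'
      set ζ := Complex.exp (2 * Real.pi * Complex.I / (m k)) ^ j
      have e : z - (a k + δ k * ζ) = δ k * ((z - a k) / δ k - ζ) := by
        field_simp; ring
      rw [e, norm_mul, Complex.norm_real, Real.norm_eq_abs, abs_of_pos hd]
      calc δ k * ‖(z - a k) / δ k - ζ‖ < δ k * (4 * s k / m k) := by gcongr
        _ = _ := by ring
    · intro N
      have := aux_listsum L _ hsum1 N
      have h2 : (0:ℝ) ≤ (1/2) ^ N := by positivity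
      linarith
    · intro N
      have := aux_listsum L _ hsum2 N
      have h2 : (0:ℝ) ≤ (1/2) ^ N := by positivity
      linarith

section AbstractPart

variable {X : Type*} [TopologicalSpace X] [CompactSpace X]

lemma aux_clamp (G : C(X, ℂ)) (c : ℝ) (hc : 0 ≤ c) :
    ∃ G' : C(X, ℂ), (∀ x, ‖G x‖ ≤ c → G' x = G x) ∧ ∀ x, ‖G' x‖ ≤ c := by
  rcases hc.eq_or_lt with rfl | hc
  · refine ⟨0, fun x hx => ?_, by simp⟩
    have : G x = 0 := by simpa using hx
    simp [this]
  · have hpos : ∀ x, 0 < max c ‖G x‖ := fun x => lt_of_lt_of_le hc (le_max_left _ _)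
    refine ⟨⟨fun x => G x * ((c / max c ‖G x‖ : ℝ) : ℂ), ?_⟩, ?_, ?_⟩
    · refine G.continuous.mul (Complex.continuous_ofReal.comp ?_)
      exact continuous_const.div (continuous_const.max G.continuous.norm) (fun x => (hpos x).ne')
    · intro x hx
      simp [max_eq_left hx, hc.ne']
    · intro x
      simp only [ContinuousMap.coe_mk, norm_mul, Complex.norm_real, Real.norm_eq_abs]
      rw [abs_of_pos (div_pos hc (hpos x)), mul_div_assoc', div_le_iff₀ (hpos x), mul_comm]
      gcongr
      exact le_max_right _ _

variable (A : Subalgebra ℂ C(X, ℂ))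

lemma aux_char_exists (hAc : IsClosed (A : Set C(X, ℂ))) (I : Ideal A) (hI : I ≠ ⊤) :
    ∃ φ : A →ₐ[ℂ] ℂ, ∀ a ∈ I, φ a = 0 := by
  have : CompleteSpace A := hAc.completeSpace_coe
  obtain ⟨M, hM, hIM⟩ := I.exists_le_maximal hI
  refine ⟨WeakDual.CharacterSpace.equivAlgHom M.toCharacterSpace, fun a ha => ?_⟩
  exact M.toCharacterSpace_apply_eq_zero_of_mem (hIM ha)

lemma aux_char_norm (hAc : IsClosed (A : Set C(X, ℂ))) (φ : A →ₐ[ℂ] ℂ) (a : A) (c : ℝ) (hc : 0 ≤ c)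
    (h : ∀ x, ‖(a : C(X, ℂ)) x‖ ≤ c) : ‖φ a‖ ≤ c := by
  have : CompleteSpace A := hAc.completeSpace_coe
  have h1 : ‖(a : C(X, ℂ))‖ ≤ c := (ContinuousMap.norm_le _ hc).2 h
  by_cases hX : Nonempty X
  · have : NormOneClass A := ⟨by
      change ‖((1 : A) : C(X, ℂ))‖ = 1
      simp⟩
    exact (AlgHom.norm_apply_le_self φ a).trans h1
  · exfalso
    have : (1 : A) = 0 := by
      apply Subtype.ext
      ext x
      exact (hX ⟨x⟩).elim
    have h2 : φ 1 = φ 0 := by rw [this]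
    simp at h2

variable {A} {K : Set X}

lemma aux_mem_of_eqOn (hA0 : ∀ F : C(X, ℂ), (∀ x ∈ K, F x = 0) → F ∈ A) {F G : C(X, ℂ)} (hG : G ∈ A) (h : ∀ x ∈ K, F x = G x) : F ∈ A := by
  have : F = (F - G) + G := by simp
  rw [this]
  exact A.add_mem (hA0 _ fun x hx => by simp [h x hx]) hG

lemma aux_mem_of_approx (hA0 : ∀ F : C(X, ℂ), (∀ x ∈ K, F x = 0) → F ∈ A) (hAc : IsClosed (A : Set C(X, ℂ))) (F : C(X, ℂ))
    (h : ∀ ε > 0, ∃ G ∈ A, ∀ x ∈ K, ‖F x - G x‖ ≤ ε) : F ∈ A := by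
  have : F ∈ closure (A : Set C(X, ℂ)) := by
    rw [Metric.mem_closure_iff]
    intro ε hε
    obtain ⟨G, hG, hGK⟩ := h (ε / 2) (by linarith)
    obtain ⟨H, hH1, hH2⟩ := aux_clamp (F - G) (ε / 2) (by linarith)
    refine ⟨F - H, ?_, ?_⟩
    · apply aux_mem_of_eqOn hA0 hG
      intro x hx
      have := hH1 x (hGK x hx)
      simp [this]
    · rw [dist_eq_norm, sub_sub_cancel]
      exact ((ContinuousMap.norm_le _ (by linarith)).2 hH2).trans_lt (by linarith)
  rwa [hAc.closure_eq] at this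

/-- characters killing the functions vanishing on `K` -/
def CharOn (hA0 : ∀ F : C(X, ℂ), (∀ x ∈ K, F x = 0) → F ∈ A) (φ : A →ₐ[ℂ] ℂ) : Prop :=
  ∀ (F : C(X, ℂ)) (h : ∀ x ∈ K, F x = 0), φ ⟨F, hA0 F h⟩ = 0

lemma aux_charOn_congr (hA0 : ∀ F : C(X, ℂ), (∀ x ∈ K, F x = 0) → F ∈ A) {φ : A →ₐ[ℂ] ℂ} (hφ : CharOn hA0 φ) (a b : A)
    (h : ∀ x ∈ K, (a : C(X, ℂ)) x = (b : C(X, ℂ)) x) : φ a = φ b := by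
  have h1 : ∀ x ∈ K, ((a : C(X, ℂ)) - b) x = 0 := fun x hx => by simp [h x hx]
  have h2 := hφ _ h1
  have h3 : (⟨(a : C(X, ℂ)) - b, hA0 _ h1⟩ : A) = a - b := rfl
  rw [h3, map_sub, sub_eq_zero] at h2
  exact h2

lemma aux_charOn_norm (hA0 : ∀ F : C(X, ℂ), (∀ x ∈ K, F x = 0) → F ∈ A) (hAc : IsClosed (A : Set C(X, ℂ))) {φ : A →ₐ[ℂ] ℂ} (hφ : CharOn hA0 φ) (a : A)
    (c : ℝ) (hc : 0 ≤ c) (h : ∀ x ∈ K, ‖(a : C(X, ℂ)) x‖ ≤ c) : ‖φ a‖ ≤ c := by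
  obtain ⟨G, hG1, hG2⟩ := aux_clamp (a : C(X, ℂ)) c hc
  have hGA : G ∈ A := aux_mem_of_eqOn hA0 a.2 (fun x hx => hG1 x (h x hx))
  rw [aux_charOn_congr hA0 hφ a ⟨G, hGA⟩ (fun x hx => (hG1 x (h x hx)).symm)]
  exact aux_char_norm A hAc φ _ c hc hG2

lemma aux_char_offK [T2Space X] (hA0 : ∀ F : C(X, ℂ), (∀ x ∈ K, F x = 0) → F ∈ A) (φ : A →ₐ[ℂ] ℂ) (hφ : ¬ CharOn hA0 φ) :
    ∃ x : X, ∀ G : A, φ G = (G : C(X, ℂ)) x := by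
  unfold CharOn at hφ
  push Not at hφ
  obtain ⟨F, hF, hne⟩ := hφ
  have hv : ∀ H : C(X, ℂ), ∀ x ∈ K, (F * H) x = 0 := fun H x hx => by simp [hF x hx]
  let e : C(X, ℂ) → A := fun H => ⟨F * H, hA0 _ (hv H)⟩
  have e0 : (⟨F, hA0 F hF⟩ : A) = e 1 := Subtype.ext (by simp [e])
  rw [e0] at hne
  let ψ : C(X, ℂ) →ₐ[ℂ] ℂ := AlgHom.ofLinearMap
    { toFun := fun H => φ (e H) / φ (e 1)
      map_add' := fun H1 H2 => by
        have : e (H1 + H2) = e H1 + e H2 := Subtype.ext (by simp [e, mul_add])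
        have h2 : φ (e H1 + e H2) = φ (e H1) + φ (e H2) := φ.toLinearMap.map_add _ _
        rw [this, h2, add_div]
      map_smul' := fun r H => by
        have : e (r • H) = r • e H := Subtype.ext (by simp [e])
        have h2 : φ (r • e H) = r • φ (e H) := φ.toLinearMap.map_smul _ _
        rw [this, h2, smul_div_assoc]; rfl }
    (by simp [hne])
    (by
      intro H1 H2
      have : e 1 * e (H1 * H2) = e H1 * e H2 := Subtype.ext (by simp only [e, MulMemClass.mk_mul_mk]; ring)
      have h2 := congrArg φ this
      rw [map_mul, map_mul] at h2
      simp only [LinearMap.coe_mk, AddHom.coe_mk]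
      field_simp
      rw [← h2, mul_comm])
  obtain ⟨x, hx⟩ := (WeakDual.CharacterSpace.continuousMapEval_bijective (X := X) (𝕜 := ℂ)).2
    (WeakDual.CharacterSpace.equivAlgHom.symm ψ)
  refine ⟨x, fun G => ?_⟩
  have h1 : ψ (G : C(X, ℂ)) = (G : C(X, ℂ)) x := by
    have := congrArg (fun χ : WeakDual.characterSpace ℂ C(X, ℂ) => χ (G : C(X, ℂ))) hx
    exact this.symm
  have h2 : ψ (G : C(X, ℂ)) = φ G := by
    change φ (e G) / φ (e 1) = φ G
    have : e G = e 1 * G := Subtype.ext (by simp [e])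
    rw [this, map_mul]
    field_simp
  rw [← h1, h2]

/-- If all `K`-characters are point evaluations, functions in `A` without zeros on `K`
are invertible on `K`. -/
lemma aux_inv (hA0 : ∀ F : C(X, ℂ), (∀ x ∈ K, F x = 0) → F ∈ A) (hAc : IsClosed (A : Set C(X, ℂ)))
    (hK : ∀ φ : A →ₐ[ℂ] ℂ, CharOn hA0 φ → ∃ x ∈ K, ∀ G : A, φ G = (G : C(X, ℂ)) x)
    (q : A) (hq : ∀ x ∈ K, (q : C(X, ℂ)) x ≠ 0) :
    ∃ a : A, ∀ x ∈ K, (a : C(X, ℂ)) x * (q : C(X, ℂ)) x = 1 := by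
  let J : Ideal A :=
    { carrier := {a | ∀ x ∈ K, (a : C(X, ℂ)) x = 0}
      add_mem' := fun {a b} ha hb x hx => by simp [ha x hx, hb x hx]
      zero_mem' := fun x hx => by simp
      smul_mem' := fun c a ha x hx => by simp [ha x hx] }
  by_cases hI : Ideal.span {q} ⊔ J = ⊤
  · have h1 : (1 : A) ∈ Ideal.span {q} ⊔ J := by rw [hI]; trivial
    obtain ⟨y, hy, z, hz, hyz⟩ := Submodule.mem_sup.1 h1
    obtain ⟨a, rfl⟩ := Ideal.mem_span_singleton'.1 hy
    refine ⟨a, fun x hx => ?_⟩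
    have h2 := congrArg (fun b : A => (b : C(X, ℂ)) x) hyz
    simpa [hz x hx] using h2
  · exfalso
    obtain ⟨φ, hφ⟩ := aux_char_exists A hAc _ hI
    obtain ⟨x, hx, hφx⟩ := hK φ (fun F h => hφ _ (Ideal.mem_sup_right h))
    apply hq x hx
    rw [← hφx]
    exact hφ _ (Ideal.mem_sup_left (Ideal.mem_span_singleton_self q))

/-- Inverse on `K` of a function in `A` close to a nonzero constant on `K`. -/
lemma aux_neumann (hA0 : ∀ F : C(X, ℂ), (∀ x ∈ K, F x = 0) → F ∈ A) (hAc : IsClosed (A : Set C(X, ℂ))) (g : A)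
    (hg : ∀ x ∈ K, ‖(g : C(X, ℂ)) x - 1‖ ≤ 1/2) :
    ∃ a : A, ∀ x ∈ K, (a : C(X, ℂ)) x * (g : C(X, ℂ)) x = 1 := by
  have : CompleteSpace A := hAc.completeSpace_coe
  obtain ⟨H, hH1, hH2⟩ := aux_clamp (1 - (g : C(X, ℂ))) (1/2) (by norm_num)
  have hHK : ∀ x ∈ K, H x = 1 - (g : C(X, ℂ)) x := fun x hx => by
    rw [hH1 x]; · simp
    have := hg x hx
    rw [norm_sub_rev] at this
    simpa using this
  have hHA : H ∈ A := aux_mem_of_eqOn hA0 (A.sub_mem A.one_mem g.2) (fun x hx => by simp [hHK x hx])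
  have hn : ‖(⟨H, hHA⟩ : A)‖ < 1 := by
    have : ‖H‖ ≤ 1/2 := (ContinuousMap.norm_le _ (by norm_num)).2 hH2
    change ‖H‖ < 1
    linarith
  refine ⟨((Units.oneSub (⟨H, hHA⟩ : A) hn)⁻¹ : Aˣ), fun x hx => ?_⟩
  have h1 := (Units.oneSub (⟨H, hHA⟩ : A) hn).inv_mul
  rw [Units.val_oneSub] at h1
  have h2 := congrArg (fun b : A => (b : C(X, ℂ)) x) h1
  simpa [hHK x hx] using h2

end AbstractPart

structure AuxSetup {X : Type*} [TopologicalSpace X] [CompactSpace X] (A : Subalgebra ℂ C(X, ℂ))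
    (K : Set X) (S : Set C(X, ℂ)) (Z W V : C(X, ℂ)) (T u : ℕ → C(X, ℂ)) (c s : ℕ → ℝ)
    (P : ℕ → Polynomial ℂ) : Prop where
  hA : A = (Algebra.adjoin ℂ S).topologicalClosure
  hA0 : ∀ F : C(X, ℂ), (∀ x ∈ K, F x = 0) → F ∈ A
  hZ : Z ∈ A
  hW : W ∈ A
  hV : V ∈ A
  hT0 : T 0 ∈ A
  hVW : ∀ x ∈ K, V x * W x = 1
  hc : ∀ k, 0 < c k
  hclim : Filter.Tendsto c Filter.atTop (nhds 0)
  hT : ∀ k, ∀ x ∈ K, T k x = c k * u k x + T (k + 1) x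
  hTn : ∀ k, ∀ x ∈ K, ‖T (k + 1) x‖ ≤ c k / 2
  hu : ∀ k, ∀ x ∈ K, u k x * (P k).eval (Z x) = 1
  hs : ∀ k, 0 < s k
  hP1 : ∀ k z, ‖z‖ ≤ 1/2 → ‖(P k).eval z‖ ≤ 1
  hP2 : ∀ z0 : ℂ, ‖z0‖ ≤ 1/2 → ∀ q > 1, ∃ k m : ℕ, 0 < m ∧ ∀ z : ℂ, ‖z‖ ≤ 1/2 →
      s k ≤ ‖(P k).eval z‖ →
      (1 - ‖z0‖ ^ 2) ^ m * ‖(P k).eval z0‖ ≤ 1/2 * q ^ m * ((1 - ‖z‖ ^ 2) ^ m * ‖(P k).eval z‖)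
  hZE : ∀ x ∈ K, ‖Z x‖ ≤ 1/2
  hZs : ∀ x ∈ K, ∀ k, s k ≤ ‖(P k).eval (Z x)‖
  hsph : ∀ x ∈ K, ‖Z x‖ ^ 2 + ‖W x‖ ^ 2 = 1
  hsurj : ∀ z w : ℂ, ‖z‖ ≤ 1/2 → (∀ k, s k ≤ ‖(P k).eval z‖) → ‖z‖ ^ 2 + ‖w‖ ^ 2 = 1 →
    ∃ x ∈ K, Z x = z ∧ W x = w
  hgen : ∀ g ∈ S, ∃ g' ∈ Algebra.adjoin ℂ ({Z, W, V, T 0} : Set C(X, ℂ)), ∀ x ∈ K, g x = g' x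

section SetupPart

variable {X : Type*} [TopologicalSpace X] [CompactSpace X] {A : Subalgebra ℂ C(X, ℂ)}
    {K : Set X} {S : Set C(X, ℂ)} {Z W V : C(X, ℂ)} {T u : ℕ → C(X, ℂ)} {c s : ℕ → ℝ}
    {P : ℕ → Polynomial ℂ}

lemma AuxSetup.closed (h : AuxSetup A K S Z W V T u c s P) : IsClosed (A : Set C(X, ℂ)) := by
  rw [h.hA]; exact Subalgebra.isClosed_topologicalClosure _

lemma aux_phi_aeval (φ : A →ₐ[ℂ] ℂ) (a : A) (p : Polynomial ℂ) :
    φ (Polynomial.aeval a p) = p.eval (φ a) := by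
  rw [← Polynomial.aeval_algHom_apply, Polynomial.coe_aeval_eq_eval]

lemma aux_coe_aeval (a : A) (p : Polynomial ℂ) (x : X) :
    ((Polynomial.aeval a p : A) : C(X, ℂ)) x = p.eval ((a : C(X, ℂ)) x) :=
  aux_phi_aeval ((ContinuousMap.evalAlgHom ℂ ℂ x).comp A.val) a p

lemma AuxSetup.mem_uT (h : AuxSetup A K S Z W V T u c s P) (k : ℕ) : u k ∈ A ∧ T k ∈ A := by
  have key : ∀ k, T k ∈ A → u k ∈ A := by
    intro k hk
    have hck := h.hc k
    have hck' : (c k : ℂ) ≠ 0 := by exact_mod_cast hck.ne'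
    let p : A := Polynomial.aeval (⟨Z, h.hZ⟩ : A) (P k)
    have hp : ∀ x, (p : C(X, ℂ)) x = (P k).eval (Z x) := fun x => aux_coe_aeval _ _ _
    let g : A := ((c k : ℂ)⁻¹) • (p * ⟨T k, hk⟩)
    have hg : ∀ x, (g : C(X, ℂ)) x = (c k : ℂ)⁻¹ * ((P k).eval (Z x) * T k x) := by
      intro x; simp [g, hp]
    obtain ⟨a, ha⟩ := aux_neumann h.hA0 h.closed g (by
      intro x hx
      rw [hg, h.hT k x hx]
      have e : (c k : ℂ)⁻¹ * ((P k).eval (Z x) * (c k * u k x + T (k + 1) x)) - 1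
          = (c k : ℂ)⁻¹ * ((P k).eval (Z x) * T (k + 1) x) := by
        have := h.hu k x hx
        field_simp
        linear_combination (c k : ℂ) * this
      rw [e, norm_mul, norm_mul, norm_inv, Complex.norm_real, Real.norm_eq_abs, abs_of_pos hck]
      have h1 := h.hP1 k (Z x) (h.hZE x hx)
      have h2 := h.hTn k x hx
      have h3 : ‖(P k).eval (Z x)‖ * ‖T (k + 1) x‖ ≤ 1 * (c k / 2) := by gcongr
      calc (c k)⁻¹ * (‖(P k).eval (Z x)‖ * ‖T (k + 1) x‖) ≤ (c k)⁻¹ * (1 * (c k / 2)) := by gcongr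
        _ = 1/2 := by field_simp)
    refine aux_mem_of_eqOn h.hA0 (((c k : ℂ)⁻¹) • (a * ⟨T k, hk⟩) : A).2 ?_
    intro x hx
    have h1 := ha x hx
    rw [hg] at h1
    have h2 := h.hu k x hx
    have h3 : (P k).eval (Z x) ≠ 0 := right_ne_zero_of_mul_eq_one h2
    simp only [SetLike.val_smul, MulMemClass.coe_mul, ContinuousMap.smul_apply,
      ContinuousMap.mul_apply, smul_eq_mul]
    apply mul_right_cancel₀ h3
    rw [h2, ← h1]; ring
  have hT : ∀ k, T k ∈ A := by
    intro k
    induction k with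
    | zero => exact h.hT0
    | succ k ih =>
      refine aux_mem_of_eqOn h.hA0 (A.sub_mem ih (A.smul_mem (key k ih) (c k : ℂ))) ?_
      intro x hx
      simp [h.hT k x hx]
  exact ⟨key k (hT k), hT k⟩

lemma AuxSetup.tail (h : AuxSetup A K S Z W V T u c s P) (a b : ℕ → ℂ) (t : ℕ → ℂ) (t' : ℕ → ℂ)
    (hab : ∀ k, a k = b k) (ht : ∀ k, t k = c k * a k + t (k + 1))
    (ht' : ∀ k, t' k = c k * b k + t' (k + 1))
    (h1 : ∀ k, ‖t (k + 1)‖ ≤ c k / 2) (h2 : ∀ k, ‖t' (k + 1)‖ ≤ c k / 2) : t 0 = t' 0 := by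
  have h3 : ∀ k, t 0 - t' 0 = t k - t' k := by
    intro k
    induction k with
    | zero => rfl
    | succ k ih => rw [ih, ht k, ht' k, hab k]; ring
  have h4 : ∀ k, ‖t 0 - t' 0‖ ≤ c k := by
    intro k
    rw [h3 (k + 1)]
    calc _ ≤ ‖t (k + 1)‖ + ‖t' (k + 1)‖ := norm_sub_le _ _
      _ ≤ c k := by linarith [h1 k, h2 k]
  have h5 : ‖t 0 - t' 0‖ ≤ 0 := ge_of_tendsto' h.hclim h4
  exact sub_eq_zero.1 (norm_le_zero_iff.1 h5)

lemma AuxSetup.char (h : AuxSetup A K S Z W V T u c s P) (φ : A →ₐ[ℂ] ℂ) (hφ : CharOn h.hA0 φ) :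
    ∃ x ∈ K, ∀ G : A, φ G = (G : C(X, ℂ)) x := by
  let Z' : A := ⟨Z, h.hZ⟩
  let W' : A := ⟨W, h.hW⟩
  let V' : A := ⟨V, h.hV⟩
  let u' : ℕ → A := fun k => ⟨u k, (h.mem_uT k).1⟩
  let T' : ℕ → A := fun k => ⟨T k, (h.mem_uT k).2⟩
  obtain ⟨z0, hz0⟩ : ∃ z0, z0 = φ Z' := ⟨_, rfl⟩
  obtain ⟨w0, hw0⟩ : ∃ w0, w0 = φ W' := ⟨_, rfl⟩
  have hz2 : ‖z0‖ ≤ 1/2 := by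
    rw [hz0]; exact aux_charOn_norm h.hA0 h.closed hφ _ _ (by norm_num) h.hZE
  have hcs : ∀ x ∈ K, ∀ k, (P k).eval (Z x) ≠ 0 := fun x hx k =>
    norm_pos_iff.1 ((h.hs k).trans_le (h.hZs x hx k))
  have hu1 : ∀ k, φ (u' k) * (P k).eval z0 = 1 := by
    intro k
    have := aux_charOn_congr h.hA0 hφ (u' k * Polynomial.aeval Z' (P k)) 1 (by
      intro x hx
      simp only [MulMemClass.coe_mul, ContinuousMap.mul_apply, aux_coe_aeval]
      simpa using h.hu k x hx)
    rwa [map_mul, map_one, aux_phi_aeval, ← hz0] at this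
  have hun : ∀ k, ∀ x ∈ K, ‖u k x‖ = ‖(P k).eval (Z x)‖⁻¹ := by
    intro k x hx
    rw [← norm_inv, eq_inv_of_mul_eq_one_left (h.hu k x hx)]
  have hPz : ∀ k, s k ≤ ‖(P k).eval z0‖ := by
    intro k
    have h1 : ‖φ (u' k)‖ ≤ (s k)⁻¹ := by
      refine aux_charOn_norm h.hA0 h.closed hφ _ _ (inv_nonneg.2 (h.hs k).le) ?_
      intro x hx
      change ‖u k x‖ ≤ _
      rw [hun k x hx]
      exact inv_anti₀ (h.hs k) (h.hZs x hx k)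
    rw [eq_inv_of_mul_eq_one_left (hu1 k), norm_inv] at h1
    have h0 : 0 < ‖(P k).eval z0‖ := norm_pos_iff.2 (right_ne_zero_of_mul_eq_one (hu1 k))
    exact (inv_le_inv₀ h0 (h.hs k)).1 h1
  have hVW : φ V' * w0 = 1 := by
    have := aux_charOn_congr h.hA0 hφ (V' * W') 1 (by
      intro x hx
      simpa using h.hVW x hx)
    rwa [map_mul, map_one, ← hw0] at this
  have hw0n : w0 ≠ 0 := right_ne_zero_of_mul_eq_one hVW
  have hle : ‖z0‖ ^ 2 + ‖w0‖ ^ 2 ≤ 1 := by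
    set D := ‖z0‖ ^ 2 + ‖w0‖ ^ 2 with hD
    have h1 : ‖φ ((starRingEnd ℂ z0) • Z' + (starRingEnd ℂ w0) • W')‖ ≤ (D + 1) / 2 := by
      refine aux_charOn_norm h.hA0 h.closed hφ _ _ (by positivity) ?_
      intro x hx
      change ‖(starRingEnd ℂ z0) * Z x + (starRingEnd ℂ w0) * W x‖ ≤ _
      have e1 := norm_add_le ((starRingEnd ℂ z0) * Z x) ((starRingEnd ℂ w0) * W x)
      rw [norm_mul, norm_mul, RCLike.norm_conj, RCLike.norm_conj] at e1
      have e2 := h.hsph x hx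
      nlinarith [sq_nonneg (‖z0‖ - ‖Z x‖), sq_nonneg (‖w0‖ - ‖W x‖)]
    have e : φ ((starRingEnd ℂ z0) • Z' + (starRingEnd ℂ w0) • W') = (D : ℂ) := by
      have e1 : φ ((starRingEnd ℂ z0) • Z' + (starRingEnd ℂ w0) • W')
        = (starRingEnd ℂ z0) * φ Z' + (starRingEnd ℂ w0) * φ W' := by
        rw [show φ ((starRingEnd ℂ z0) • Z' + (starRingEnd ℂ w0) • W')
          = φ ((starRingEnd ℂ z0) • Z') + φ ((starRingEnd ℂ w0) • W') from φ.toLinearMap.map_add _ _,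
          show φ ((starRingEnd ℂ z0) • Z') = _ from φ.toLinearMap.map_smul _ _,
          show φ ((starRingEnd ℂ w0) • W') = _ from φ.toLinearMap.map_smul _ _]
        rfl
      rw [e1, ← hz0, ← hw0, Complex.conj_mul', Complex.conj_mul', hD]
      push_cast; rfl
    rw [e, Complex.norm_real, Real.norm_eq_abs] at h1
    have := le_abs_self D
    linarith
  have hge : 1 ≤ ‖z0‖ ^ 2 + ‖w0‖ ^ 2 := by
    have key : ∀ q > 1, 1 - ‖z0‖ ^ 2 ≤ q * ‖w0‖ ^ 2 := by
      intro q hq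
      obtain ⟨k, m, hm, hkm⟩ := h.hP2 z0 hz2 q hq
      have hpz : 0 < ‖(P k).eval z0‖ := (h.hs k).trans_le (hPz k)
      have hz1 : 0 < 1 - ‖z0‖ ^ 2 := by nlinarith [norm_nonneg z0]
      have hq0 : 0 < q := by linarith
      have h1 : ‖φ (u' k * V' ^ (2 * m))‖ ≤
          1/2 * q ^ m * ((1 - ‖z0‖ ^ 2) ^ m * ‖(P k).eval z0‖)⁻¹ := by
        refine aux_charOn_norm h.hA0 h.closed hφ _ _ (by positivity) ?_
        intro x hx
        change ‖u k x * V x ^ (2 * m)‖ ≤ _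
        have e1 : ‖V x‖ = ‖W x‖⁻¹ := by
          rw [← norm_inv, eq_inv_of_mul_eq_one_left (h.hVW x hx)]
        have e2 : ‖W x‖ ^ 2 = 1 - ‖Z x‖ ^ 2 := by linarith [h.hsph x hx]
        have hz3 : 0 < 1 - ‖Z x‖ ^ 2 := by nlinarith [norm_nonneg (Z x), h.hZE x hx]
        rw [norm_mul, norm_pow, e1, hun k x hx, inv_pow, pow_mul, e2]
        have h3 := hkm (Z x) (h.hZE x hx) (h.hZs x hx k)
        have hpx : 0 < ‖(P k).eval (Z x)‖ := (h.hs k).trans_le (h.hZs x hx k)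
        rw [← mul_inv, ← div_eq_mul_inv, inv_eq_one_div, div_le_div_iff₀ (by positivity) (by positivity)]
        linarith
      rw [map_mul, map_pow, norm_mul, norm_pow, eq_inv_of_mul_eq_one_left (hu1 k),
        eq_inv_of_mul_eq_one_left hVW, norm_inv, norm_inv, inv_pow, pow_mul] at h1
      have hw1 : 0 < ‖w0‖ := norm_pos_iff.2 hw0n
      rw [← mul_inv, ← div_eq_mul_inv, inv_eq_one_div, div_le_div_iff₀ (by positivity) (by positivity)] at h1
      have h2 : (1 - ‖z0‖ ^ 2) ^ m ≤ (q * ‖w0‖ ^ 2) ^ m := by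
        have h3 : (1 - ‖z0‖ ^ 2) ^ m ≤ 1/2 * (q ^ m * (‖w0‖ ^ 2) ^ m) := by
          apply le_of_mul_le_mul_right _ hpz
          linarith
        rw [mul_pow]
        have : 0 < q ^ m * (‖w0‖ ^ 2) ^ m := by positivity
        linarith
      exact le_of_pow_le_pow_left₀ hm.ne' (by positivity) h2
    by_contra hlt
    push Not at hlt
    have hw1 : 0 < ‖w0‖ ^ 2 := by have := norm_pos_iff.2 hw0n; positivity
    have h1 := key ((1 - ‖z0‖ ^ 2 + ‖w0‖ ^ 2) / (2 * ‖w0‖ ^ 2)) (by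
      rw [gt_iff_lt, lt_div_iff₀ (by positivity)]; linarith)
    have h2 : (1 - ‖z0‖ ^ 2 + ‖w0‖ ^ 2) / (2 * ‖w0‖ ^ 2) * ‖w0‖ ^ 2 = (1 - ‖z0‖ ^ 2 + ‖w0‖ ^ 2) / 2 := by
      field_simp
    rw [h2] at h1
    linarith
  obtain ⟨x, hxK, hxZ, hxW⟩ := h.hsurj z0 w0 hz2 hPz (le_antisymm hle hge)
  refine ⟨x, hxK, ?_⟩
  have hφV : φ V' = V x := by
    have := h.hVW x hxK
    rw [hxW] at this
    exact mul_right_cancel₀ hw0n (hVW.trans this.symm)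
  have hφT : φ (T' 0) = T 0 x := by
    refine h.tail (fun k => φ (u' k)) (fun k => u k x) (fun k => φ (T' k)) (fun k => T k x) ?_ ?_ ?_ ?_ ?_
    · intro k
      have := h.hu k x hxK
      rw [hxZ] at this
      exact mul_right_cancel₀ (right_ne_zero_of_mul_eq_one this) ((hu1 k).trans this.symm)
    · intro k
      have := aux_charOn_congr h.hA0 hφ (T' k) ((c k : ℂ) • u' k + T' (k + 1)) (by
        intro y hy
        exact h.hT k y hy)
      rw [this, show φ ((c k : ℂ) • u' k + T' (k + 1)) = φ ((c k : ℂ) • u' k) + φ (T' (k + 1)) from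
        φ.toLinearMap.map_add _ _, show φ ((c k : ℂ) • u' k) = _ from φ.toLinearMap.map_smul _ _]
      rfl
    · exact fun k => h.hT k x hxK
    · exact fun k => aux_charOn_norm h.hA0 h.closed hφ _ _ (by have := h.hc k; positivity) (h.hTn k)
    · exact fun k => h.hTn k x hxK
  have hgen0 : ∀ g ∈ Algebra.adjoin ℂ ({Z, W, V, T 0} : Set C(X, ℂ)), ∃ hg : g ∈ A, φ ⟨g, hg⟩ = g x := by
    intro g hg
    induction hg using Algebra.adjoin_induction with
    | mem y hy =>
      rcases hy with rfl | rfl | rfl | rfl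
      · exact ⟨h.hZ, by rw [hxZ, hz0]⟩
      · exact ⟨h.hW, by rw [hxW, hw0]⟩
      · exact ⟨h.hV, hφV⟩
      · exact ⟨h.hT0, hφT⟩
    | algebraMap r => exact ⟨A.algebraMap_mem r, φ.commutes r⟩
    | add a b _ _ ha hb =>
      obtain ⟨ha, ha'⟩ := ha
      obtain ⟨hb, hb'⟩ := hb
      refine ⟨A.add_mem ha hb, ?_⟩
      rw [ContinuousMap.add_apply, ← ha', ← hb']
      exact φ.toLinearMap.map_add ⟨a, ha⟩ ⟨b, hb⟩
    | mul a b _ _ ha hb =>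
      obtain ⟨ha, ha'⟩ := ha
      obtain ⟨hb, hb'⟩ := hb
      refine ⟨A.mul_mem ha hb, ?_⟩
      rw [ContinuousMap.mul_apply, ← ha', ← hb']
      exact map_mul φ ⟨a, ha⟩ ⟨b, hb⟩
  have hSA : S ⊆ A := by
    rw [h.hA]
    exact Algebra.subset_adjoin.trans (Subalgebra.le_topologicalClosure _)
  have hgen1 : ∀ g ∈ Algebra.adjoin ℂ S, ∃ hg : g ∈ A, φ ⟨g, hg⟩ = g x := by
    intro g hg
    induction hg using Algebra.adjoin_induction with
    | mem y hy =>
      obtain ⟨g', hg', hgg'⟩ := h.hgen y hy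
      obtain ⟨h1, h2⟩ := hgen0 g' hg'
      refine ⟨hSA hy, ?_⟩
      rw [hgg' x hxK, ← h2]
      exact aux_charOn_congr h.hA0 hφ _ _ hgg'
    | algebraMap r => exact ⟨A.algebraMap_mem r, φ.commutes r⟩
    | add a b _ _ ha hb =>
      obtain ⟨ha, ha'⟩ := ha
      obtain ⟨hb, hb'⟩ := hb
      refine ⟨A.add_mem ha hb, ?_⟩
      rw [ContinuousMap.add_apply, ← ha', ← hb']
      exact φ.toLinearMap.map_add ⟨a, ha⟩ ⟨b, hb⟩
    | mul a b _ _ ha hb =>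
      obtain ⟨ha, ha'⟩ := ha
      obtain ⟨hb, hb'⟩ := hb
      refine ⟨A.mul_mem ha hb, ?_⟩
      rw [ContinuousMap.mul_apply, ← ha', ← hb']
      exact map_mul φ ⟨a, ha⟩ ⟨b, hb⟩
  intro G
  have hG : (G : C(X, ℂ)) ∈ closure ((Algebra.adjoin ℂ S : Subalgebra ℂ C(X, ℂ)) : Set C(X, ℂ)) := by
    have hle : A ≤ (Algebra.adjoin ℂ S).topologicalClosure := h.hA.le
    exact hle G.2
  have hb : ∀ ε > 0, ‖φ G - (G : C(X, ℂ)) x‖ ≤ 0 + ε := by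
    intro ε hε
    obtain ⟨G', hG', hd⟩ := Metric.mem_closure_iff.1 hG (ε / 2) (by positivity)
    obtain ⟨hG'A, e⟩ := hgen1 G' hG'
    have hn : ∀ y, ‖((G : C(X, ℂ)) - G') y‖ ≤ ε / 2 := fun y =>
      (ContinuousMap.norm_coe_le_norm _ y).trans (by rw [← dist_eq_norm]; exact hd.le)
    have h1 : ‖φ (G - ⟨G', hG'A⟩)‖ ≤ ε / 2 := aux_char_norm A h.closed φ _ _ (by positivity) hn
    have h2 : φ (G - ⟨G', hG'A⟩) = φ G - φ ⟨G', hG'A⟩ := φ.toLinearMap.map_sub _ _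
    have h3 : φ G - (G : C(X, ℂ)) x = φ (G - ⟨G', hG'A⟩) - ((G : C(X, ℂ)) - G') x := by
      rw [h2, e, ContinuousMap.sub_apply]; ring
    rw [h3]
    calc _ ≤ ‖φ (G - ⟨G', hG'A⟩)‖ + ‖((G : C(X, ℂ)) - G') x‖ := norm_sub_le _ _
      _ ≤ 0 + ε := by linarith [hn x]
  exact sub_eq_zero.1 (norm_le_zero_iff.1 (le_of_forall_pos_le_add hb))

end SetupPart

section NonDense

lemma aux_poly_coeff (p : Polynomial ℂ) (r C : ℝ) (hr : 0 < r) (d : ℕ)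
    (hp : ∀ w : ℂ, ‖w‖ = r → ‖p.eval w‖ ≤ C * r ^ d) : ‖p.coeff d‖ ≤ C := by
  have hit : ∀ n, iteratedDeriv n (fun w => p.eval w) = fun w => (Polynomial.derivative^[n] p).eval w := by
    intro n
    induction n with
    | zero => simp
    | succ n ih =>
      rw [iteratedDeriv_succ, ih]
      funext w
      rw [Polynomial.deriv, Function.iterate_succ_apply']
  have h1 := Complex.norm_iteratedDeriv_le_of_forall_mem_sphere_norm_le (c := 0) (R := r)
    (C := C * r ^ d) (f := fun w => p.eval w) d hr (p.differentiable.diffContOnCl)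
    (fun z hz => hp z (by simpa using hz))
  rw [hit] at h1
  simp only at h1
  rw [← Polynomial.coeff_zero_eq_eval_zero, Polynomial.coeff_iterate_derivative] at h1
  simp only [zero_add, Nat.descFactorial_self, nsmul_eq_mul, norm_mul, Complex.norm_natCast] at h1
  have h2 : (d.factorial : ℝ) * (C * r ^ d) / r ^ d = d.factorial * C := by field_simp
  rw [h2] at h1
  exact le_of_mul_le_mul_left h1 (by exact_mod_cast d.factorial_pos)

variable {X : Type*} [TopologicalSpace X] [CompactSpace X] {A : Subalgebra ℂ C(X, ℂ)}
    {K : Set X} {S : Set C(X, ℂ)} {Z W V : C(X, ℂ)} {T u : ℕ → C(X, ℂ)} {c s : ℕ → ℝ}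
    {P : ℕ → Polynomial ℂ}

lemma AuxSetup.ne_top (h : AuxSetup A K S Z W V T u c s P)
    (hd : ∃ ε > 0, ∀ g ∈ Algebra.adjoin ℂ ({id} ∪ Set.range (fun k => fun z : ℂ => ((P k).eval z)⁻¹)),
      ∃ z : ℂ, ‖z‖ ≤ 1/2 ∧ (∀ k, s k ≤ ‖(P k).eval z‖) ∧ ε ≤ ‖(starRingEnd ℂ) z - g z‖) :
    star Z ∉ A := by
  obtain ⟨ε, hε, hd⟩ := hd
  intro hZA
  set R : Subalgebra ℂ (ℂ → ℂ) :=
    Algebra.adjoin ℂ ({id} ∪ Set.range (fun k => fun z : ℂ => ((P k).eval z)⁻¹)) with hR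
  let ev : ℂ → (R →+* ℂ) := fun z => ((Pi.evalRingHom (fun _ : ℂ => ℂ) z).comp R.subtype)
  have hWne : ∀ x ∈ K, W x ≠ 0 := fun x hx => right_ne_zero_of_mul_eq_one (h.hVW x hx)
  let B : Subalgebra ℂ C(X, ℂ) :=
    { carrier := {G | ∃ d : ℕ, ∃ Q : Polynomial R, ∀ x ∈ K,
        W x ^ d * G x = Q.eval₂ (ev (Z x)) (W x)}
      mul_mem' := by
        rintro a b ⟨d1, Q1, h1⟩ ⟨d2, Q2, h2⟩
        refine ⟨d1 + d2, Q1 * Q2, fun x hx => ?_⟩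
        rw [Polynomial.eval₂_mul, ← h1 x hx, ← h2 x hx, ContinuousMap.mul_apply]
        ring
      add_mem' := by
        rintro a b ⟨d1, Q1, h1⟩ ⟨d2, Q2, h2⟩
        refine ⟨d1 + d2, Polynomial.X ^ d2 * Q1 + Polynomial.X ^ d1 * Q2, fun x hx => ?_⟩
        rw [Polynomial.eval₂_add, Polynomial.eval₂_mul, Polynomial.eval₂_mul, ← h1 x hx, ← h2 x hx,
          ContinuousMap.add_apply]
        simp only [Polynomial.eval₂_X_pow]
        ring
      algebraMap_mem' := by
        intro r
        refine ⟨0, Polynomial.C (algebraMap ℂ R r), fun x hx => ?_⟩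
        simp [ev] }
  have hB0 : ∀ F : C(X, ℂ), (∀ x ∈ K, F x = 0) → F ∈ B.topologicalClosure := by
    intro F hF
    apply B.le_topologicalClosure
    exact ⟨0, 0, fun x hx => by simp [hF x hx]⟩
  have hBZ : Z ∈ B := ⟨0, Polynomial.C ⟨id, Algebra.subset_adjoin (by simp)⟩, fun x hx => by
    simp [ev]⟩
  have hBW : W ∈ B := ⟨0, Polynomial.X, fun x hx => by simp⟩
  have hBV : V ∈ B := ⟨1, 1, fun x hx => by
    rw [pow_one, mul_comm, h.hVW x hx]; simp⟩
  have hBu : ∀ k, u k ∈ B := fun k =>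
    ⟨0, Polynomial.C ⟨fun z : ℂ => ((P k).eval z)⁻¹, Algebra.subset_adjoin (by simp)⟩, fun x hx => by
      simp [ev, eq_inv_of_mul_eq_one_left (h.hu k x hx)]⟩
  have hBc : IsClosed (B.topologicalClosure : Set C(X, ℂ)) := Subalgebra.isClosed_topologicalClosure _
  have hTs : ∀ k, ∃ G ∈ B, ∀ x ∈ K, T 0 x - G x = T k x := by
    intro k
    induction k with
    | zero => exact ⟨0, B.zero_mem, fun x hx => by simp⟩
    | succ k ih =>
      obtain ⟨G, hG, hGx⟩ := ih
      refine ⟨G + (c k : ℂ) • u k, B.add_mem hG (B.smul_mem (hBu k) _), fun x hx => ?_⟩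
      have h1 := hGx x hx
      rw [h.hT k x hx] at h1
      simp only [ContinuousMap.add_apply, ContinuousMap.smul_apply, smul_eq_mul]
      linear_combination h1
  have hBT : T 0 ∈ B.topologicalClosure := by
    apply aux_mem_of_approx hB0 hBc
    intro δ hδ
    obtain ⟨k, hk⟩ := ((h.hclim.eventually (gt_mem_nhds hδ))).exists
    obtain ⟨G, hG, hGx⟩ := hTs (k + 1)
    refine ⟨G, B.le_topologicalClosure hG, fun x hx => ?_⟩
    rw [hGx x hx]
    have := h.hTn k x hx
    have := h.hc k
    linarith
  have h4 : Algebra.adjoin ℂ ({Z, W, V, T 0} : Set C(X, ℂ)) ≤ B.topologicalClosure := by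
    apply Algebra.adjoin_le
    rintro y (rfl | rfl | rfl | rfl)
    · exact B.le_topologicalClosure hBZ
    · exact B.le_topologicalClosure hBW
    · exact B.le_topologicalClosure hBV
    · exact hBT
  have hAB : A ≤ B.topologicalClosure := by
    rw [h.hA]
    apply Subalgebra.topologicalClosure_minimal _ hBc
    apply Algebra.adjoin_le
    intro g hg
    obtain ⟨g', hg', e⟩ := h.hgen g hg
    exact aux_mem_of_eqOn hB0 (h4 hg') e
  have hcl : star Z ∈ closure (B : Set C(X, ℂ)) := hAB hZA
  obtain ⟨G, ⟨d, Q, hQ⟩, hdist⟩ := Metric.mem_closure_iff.1 hcl (ε / 2) (by positivity)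
  obtain ⟨z, hz1, hz2, hz3⟩ := hd (Q.coeff d : ℂ → ℂ) (Q.coeff d).2
  have hz0 : 0 < 1 - ‖z‖ ^ 2 := by nlinarith [norm_nonneg z]
  have hfin := aux_poly_coeff (Polynomial.C ((starRingEnd ℂ) z) * Polynomial.X ^ d - Q.map (ev z))
    (Real.sqrt (1 - ‖z‖ ^ 2)) (ε / 2) (Real.sqrt_pos.2 hz0) d (by
      intro w hw
      have hw2 : ‖z‖ ^ 2 + ‖w‖ ^ 2 = 1 := by
        rw [hw, Real.sq_sqrt hz0.le]; ring
      obtain ⟨x, hxK, hxZ, hxW⟩ := h.hsurj z w hz1 hz2 hw2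
      have h1 := hQ x hxK
      rw [hxZ, hxW] at h1
      have h2 : ‖(starRingEnd ℂ) z - G x‖ ≤ ε / 2 := by
        have := ContinuousMap.dist_apply_le_dist (f := star Z) (g := G) x
        rw [dist_eq_norm] at this
        have h3 : (star Z) x = (starRingEnd ℂ) z := by rw [← hxZ]; rfl
        rw [h3] at this
        exact this.trans hdist.le
      have h4 : (Polynomial.C ((starRingEnd ℂ) z) * Polynomial.X ^ d - Q.map (ev z)).eval w
          = w ^ d * ((starRingEnd ℂ) z - G x) := by
        simp only [Polynomial.eval_sub, Polynomial.eval_mul, Polynomial.eval_C, Polynomial.eval_pow,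
          Polynomial.eval_X, Polynomial.eval_map]
        rw [← h1]; ring
      rw [h4, norm_mul, norm_pow, hw, mul_comm]
      gcongr)
  simp only [Polynomial.coeff_sub, Polynomial.coeff_C_mul, Polynomial.coeff_X_pow, if_true, mul_one,
    Polynomial.coeff_map] at hfin
  have : ev z (Q.coeff d) = (Q.coeff d : ℂ → ℂ) z := rfl
  rw [this] at hfin
  linarith

end NonDense

section Hull

variable {X : Type*} [TopologicalSpace X] [CompactSpace X]

/-- points of the (abstract) hull give characters -/
lemma aux_hull_char {m : ℕ} (A : Subalgebra ℂ C(X, ℂ)) (g : Fin m → C(X, ℂ))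
    (hA : A = (Algebra.adjoin ℂ (Set.range g)).topologicalClosure) (hg : ∀ i, g i ∈ A) (y : Fin m → ℂ)
    (hy : ∀ (p : MvPolynomial (Fin m) ℂ) (C : ℝ), 0 ≤ C →
      (∀ x, ‖MvPolynomial.eval (fun i => g i x) p‖ ≤ C) → ‖MvPolynomial.eval y p‖ ≤ C) :
    ∃ φ : A →ₐ[ℂ] ℂ, ∀ i, φ ⟨g i, hg i⟩ = y i := by
  have hAc : IsClosed (A : Set C(X, ℂ)) := by
    rw [hA]; exact Subalgebra.isClosed_topologicalClosure _
  let b : Fin m → A := fun i => ⟨g i, hg i⟩ - algebraMap ℂ A (y i)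
  have hI : Ideal.span (Set.range b) ≠ ⊤ := by
    intro htop
    have h1 : (1 : A) ∈ Ideal.span (Set.range b) := by rw [htop]; trivial
    obtain ⟨a, ha⟩ := (Ideal.mem_span_range_iff_exists_fun).1 h1
    let M : ℝ := ∑ i, ‖(b i : C(X, ℂ))‖
    have hM : 0 ≤ M := Finset.sum_nonneg fun i _ => norm_nonneg _
    have happ : ∀ i, ∃ p : MvPolynomial (Fin m) ℂ, ∀ x, ‖(a i : C(X, ℂ)) x - MvPolynomial.eval (fun i => g i x) p‖
        ≤ 1 / (2 * (M + 1)) := by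
      intro i
      have hcl : (a i : C(X, ℂ)) ∈ closure ((Algebra.adjoin ℂ (Set.range g) : Subalgebra ℂ C(X, ℂ)) : Set C(X, ℂ)) :=
        hA.le (a i).2
      obtain ⟨G, hG, hd⟩ := Metric.mem_closure_iff.1 hcl (1 / (2 * (M + 1))) (by positivity)
      rw [SetLike.mem_coe, Algebra.adjoin_range_eq_range_aeval] at hG
      obtain ⟨p, rfl⟩ := hG
      refine ⟨p, fun x => ?_⟩
      have e : (MvPolynomial.aeval g p : C(X, ℂ)) x = MvPolynomial.eval (fun i => g i x) p := by
        have := MvPolynomial.map_aeval g (ContinuousMap.evalAlgHom ℂ ℂ x : C(X, ℂ) →ₐ[ℂ] ℂ).toRingHom p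
        have h2 : ((ContinuousMap.evalAlgHom ℂ ℂ x : C(X, ℂ) →ₐ[ℂ] ℂ).toRingHom).comp (algebraMap ℂ C(X, ℂ))
          = RingHom.id ℂ := by ext; rfl
        rw [h2] at this
        exact this
      rw [← e, ← dist_eq_norm]
      exact (ContinuousMap.dist_apply_le_dist x).trans hd.le
    choose p hp using happ
    have h2 := hy (1 - ∑ i, p i * (MvPolynomial.X i - MvPolynomial.C (y i))) (1/2) (by norm_num) (by
      intro x
      have h3 := congrArg (fun c : A => (c : C(X, ℂ)) x) ha
      have h4 : ∑ i, (a i : C(X, ℂ)) x * (b i : C(X, ℂ)) x = 1 := by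
        have : ((∑ i, a i * b i : A) : C(X, ℂ)) x = ∑ i, (a i : C(X, ℂ)) x * (b i : C(X, ℂ)) x := by
          rw [AddSubmonoidClass.coe_finsetSum, ContinuousMap.sum_apply]; rfl
        rw [← this, ha]; rfl
      have h5 : ∀ i, (b i : C(X, ℂ)) x = g i x - y i := fun i => rfl
      simp only [map_sub, map_one, map_sum, map_mul, MvPolynomial.eval_X, MvPolynomial.eval_C]
      rw [← h4, ← Finset.sum_sub_distrib]
      calc _ ≤ ∑ i, 1 / (2 * (M + 1)) * ‖(b i : C(X, ℂ))‖ := by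
            refine norm_sum_le_of_le _ fun i _ => ?_
            rw [h5, ← sub_mul, norm_mul]
            refine mul_le_mul (hp i x) ?_ (norm_nonneg _) (by positivity)
            rw [← h5]
            exact ContinuousMap.norm_coe_le_norm _ x
        _ = M / (2 * (M + 1)) := by rw [← Finset.mul_sum]; ring
        _ ≤ 1/2 := by rw [div_le_div_iff₀ (by positivity) (by norm_num)]; linarith)
    simp at h2
    norm_num at h2
  obtain ⟨φ, hφ⟩ := aux_char_exists A hAc _ hI
  refine ⟨φ, fun i => ?_⟩
  have h1 := hφ (b i) (Ideal.subset_span ⟨i, rfl⟩)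
  have h2 : φ (b i) = φ ⟨g i, hg i⟩ - φ (algebraMap ℂ A (y i)) := φ.toLinearMap.map_sub _ _
  rw [h2, φ.commutes] at h1
  exact sub_eq_zero.1 h1

end Hull

section SW

variable {X : Type*} [TopologicalSpace X] [CompactSpace X]

lemma aux_sw {n : ℕ} (A : Subalgebra ℂ C(X, ℂ)) (hAc : IsClosed (A : Set C(X, ℂ)))
    (ρ : C(X, ℂ)) (e : Fin n → C(X, ℂ)) (K : Set X) (hρ0 : ∀ x, ρ x = 0 → x ∈ K)
    (hρs : star ρ = ρ) (hρ : ρ ∈ A) (hρe : ∀ i, ρ * e i ∈ A) (hρe' : ∀ i, ρ * star (e i) ∈ A)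
    (hsep : ∀ x y, (∀ i, e i x = e i y) → x = y) (F : C(X, ℂ)) (hF : ∀ x ∈ K, F x = 0) : F ∈ A := by
  let Φ0 : C(X, ℂ × (Fin n → ℂ)) := ⟨fun x => (ρ x, fun i => ρ x * e i x), by fun_prop⟩
  let Y := Set.range Φ0
  have hYc : CompactSpace Y := isCompact_iff_compactSpace.1 (isCompact_range Φ0.continuous)
  let Φ : C(X, Y) := ⟨Set.rangeFactorization Φ0, Φ0.continuous.subtype_mk _⟩
  have hsurj : Function.Surjective Φ := Set.rangeFactorization_surjective
  have hq : Topology.IsQuotientMap Φ :=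
    (Φ.continuous.isClosedMap).isQuotientMap Φ.continuous hsurj
  have hfib : ∀ a b, Φ a = Φ b → F a = F b := by
    intro a b hab
    have h0 : Φ0 a = Φ0 b := congrArg Subtype.val hab
    have h1 : ρ a = ρ b := congrArg Prod.fst h0
    have h2 : ∀ i, ρ a * e i a = ρ b * e i b := fun i => congrFun (congrArg Prod.snd h0) i
    by_cases hz : ρ a = 0
    · rw [hF a (hρ0 a hz), hF b (hρ0 b (h1 ▸ hz))]
    · have : a = b := hsep a b fun i => by
        have := h2 i
        rw [← h1] at this
        exact mul_left_cancel₀ hz this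
      rw [this]
  let B : StarSubalgebra ℂ C(Y, ℂ) :=
    { carrier := {G | G.comp Φ ∈ A ∧ (star G).comp Φ ∈ A}
      mul_mem' := by
        rintro a b ⟨h1, h2⟩ ⟨h3, h4⟩
        refine ⟨A.mul_mem h1 h3, ?_⟩
        rw [star_mul']
        exact A.mul_mem h2 h4
      add_mem' := by
        rintro a b ⟨h1, h2⟩ ⟨h3, h4⟩
        refine ⟨A.add_mem h1 h3, ?_⟩
        rw [star_add]
        exact A.add_mem h2 h4
      algebraMap_mem' := by
        intro r
        refine ⟨A.algebraMap_mem r, ?_⟩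
        exact A.algebraMap_mem (star r)
      star_mem' := by
        rintro a ⟨h1, h2⟩
        exact ⟨h2, by rwa [star_star]⟩ }
  have hBsep : B.SeparatesPoints := by
    intro y y' hyy'
    by_cases h1 : (y : ℂ × (Fin n → ℂ)).1 = (y' : ℂ × (Fin n → ℂ)).1
    · have h2 : ∃ i, (y : ℂ × (Fin n → ℂ)).2 i ≠ (y' : ℂ × (Fin n → ℂ)).2 i := by
        by_contra hcon
        push Not at hcon
        exact hyy' (Subtype.ext (Prod.ext h1 (funext hcon)))
      obtain ⟨i, hi⟩ := h2
      let G : C(Y, ℂ) := ⟨fun y => (y : ℂ × (Fin n → ℂ)).2 i, by fun_prop⟩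
      refine ⟨G, ⟨G, ⟨?_, ?_⟩, rfl⟩, hi⟩
      · have : G.comp Φ = ρ * e i := by ext x; rfl
        rw [this]; exact hρe i
      · have : (star G).comp Φ = star ρ * star (e i) := by
          ext x; exact map_mul (starRingEnd ℂ) (ρ x) (e i x)
        rw [this, hρs]; exact hρe' i
    · let G : C(Y, ℂ) := ⟨fun y => (y : ℂ × (Fin n → ℂ)).1, by fun_prop⟩
      refine ⟨G, ⟨G, ⟨?_, ?_⟩, rfl⟩, h1⟩
      · exact hρ
      · have : (star G).comp Φ = star ρ := by ext x; rfl
        rw [this, hρs]; exact hρ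
  have htop := ContinuousMap.starSubalgebra_topologicalClosure_eq_top_of_separatesPoints B hBsep
  have hcont : Continuous (fun G : C(Y, ℂ) => G.comp Φ) := ContinuousMap.continuous_precomp Φ
  have hmem : hq.lift F hfib ∈ closure (B : Set C(Y, ℂ)) := by
    have : hq.lift F hfib ∈ B.topologicalClosure := by rw [htop]; trivial
    exact this
  have hsub : closure (B : Set C(Y, ℂ)) ⊆ (fun G : C(Y, ℂ) => G.comp Φ) ⁻¹' (A : Set C(X, ℂ)) :=
    closure_minimal (fun G hG => hG.1) (hAc.preimage hcont)
  have h3 := hsub hmem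
  have h4 : (hq.lift F hfib).comp Φ = F := Topology.IsQuotientMap.lift_comp hq F hfib
  rw [Set.mem_preimage, h4] at h3
  exact h3

end SW

lemma aux_series {E : Type*} [NormedAddCommGroup E] [NormedSpace ℝ E] (u : ℕ → E → ℂ)
    (hu : ∀ k, ContDiff ℝ (⊤ : ℕ∞) (u k)) (hs : ∀ k, HasCompactSupport (u k)) :
    ∃ (c : ℕ → ℝ) (T : ℕ → E → ℂ), (∀ k, 0 < c k) ∧ Filter.Tendsto c Filter.atTop (nhds 0) ∧
      ContDiff ℝ (⊤ : ℕ∞) (T 0) ∧ (∀ k, Continuous (T k)) ∧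
      (∀ k x, T k x = c k * u k x + T (k + 1) x) ∧ ∀ k x, ‖T (k + 1) x‖ ≤ c k / 2 := by
  have hb : ∀ k i : ℕ, ∃ C : ℝ, ∀ x, ‖iteratedFDeriv ℝ i (u k) x‖ ≤ C := fun k i =>
    ((hu k).continuous_iteratedFDeriv (by exact_mod_cast le_top)).bounded_above_of_compact_support
      ((hs k).iteratedFDeriv i)
  choose C hC using hb
  let B : ℕ → ℝ := fun k => 1 + ∑ i ∈ Finset.range (k + 1), |C k i|
  have hB1 : ∀ k, 1 ≤ B k := fun k => by
    have : 0 ≤ ∑ i ∈ Finset.range (k + 1), |C k i| := Finset.sum_nonneg fun i _ => abs_nonneg _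
    simp only [B]; linarith
  have hB2 : ∀ k i, i ≤ k → ∀ x, ‖iteratedFDeriv ℝ i (u k) x‖ ≤ B k := by
    intro k i hik x
    have h1 : |C k i| ≤ ∑ i ∈ Finset.range (k + 1), |C k i| :=
      Finset.single_le_sum (f := fun i => |C k i|) (fun i _ => abs_nonneg _)
        (Finset.mem_range.2 (by omega))
    have h2 := hC k i x
    have h3 := le_abs_self (C k i)
    simp only [B]; linarith
  have hB3 : ∀ k x, ‖u k x‖ ≤ B k := fun k x => by
    have := hB2 k 0 (Nat.zero_le _) x
    rwa [norm_iteratedFDeriv_zero] at this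
  let D : ℕ → ℝ := fun k => ∏ i ∈ Finset.range k, (1 / (4 * B i))
  have hD0 : ∀ k, 0 < D k := fun k => Finset.prod_pos fun i _ => by
    have := hB1 i; positivity
  have hDs : ∀ k, D (k + 1) * B k = D k / 4 := fun k => by
    simp only [D, Finset.prod_range_succ]
    have := hB1 k
    field_simp
  have hDs' : ∀ k, D (k + 1) ≤ D k / 4 := fun k => by
    rw [← hDs]; nlinarith [hD0 (k + 1), hB1 k]
  have hDg : ∀ k j, D (j + k) ≤ D k * (1/4) ^ j := by
    intro k j
    induction j with
    | zero => simp
    | succ j ih =>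
      have := hDs' (j + k)
      rw [show j + 1 + k = j + k + 1 by ring, pow_succ]
      linarith
  let f : ℕ → E → ℂ := fun k x => (D (k + 1) : ℂ) * u k x
  have hgs : Summable (fun j : ℕ => ((1:ℝ)/4) ^ j) :=
    summable_geometric_of_lt_one (by norm_num) (by norm_num)
  have hfn : ∀ k x, ‖f k x‖ ≤ D k / 4 := by
    intro k x
    simp only [f, norm_mul, Complex.norm_real, Real.norm_eq_abs, abs_of_pos (hD0 (k + 1))]
    rw [← hDs k]
    have := hD0 (k + 1)
    gcongr
    exact hB3 k x
  have hfsum : ∀ k x, Summable (fun j => f (j + k) x) := by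
    intro k x
    refine Summable.of_norm_bounded (g := fun j => D k / 4 * (1/4) ^ j) (hgs.mul_left _) ?_
    intro j
    have := hDg k j
    have := hfn (j + k) x
    linarith
  let T : ℕ → E → ℂ := fun k x => ∑' j, f (j + k) x
  have hTrec : ∀ k x, T k x = (D (k + 1) : ℂ) * u k x + T (k + 1) x := by
    intro k x
    simp only [T]
    rw [(hfsum k x).tsum_eq_zero_add]
    simp only [zero_add]
    congr 1
    refine tsum_congr fun j => ?_
    rw [show j + 1 + k = j + (k + 1) by ring]
  have hT0 : ContDiff ℝ (⊤ : ℕ∞) (T 0) := by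
    refine contDiff_tsum_of_eventually (v := fun _ j => D 0 / 4 * (1/4) ^ j) ?_ ?_ ?_
    · intro i
      exact contDiff_const.mul (hu _)
    · intro k _
      exact hgs.mul_left _
    · intro k hk
      rw [Nat.cofinite_eq_atTop]
      filter_upwards [Filter.eventually_ge_atTop k] with i hi x
      have e : (f (i + 0)) = (D (i + 1)) • (u i) := by
        funext y; simp [f]
      rw [e, iteratedFDeriv_const_smul_apply]
      · rw [norm_smul, Real.norm_eq_abs, abs_of_pos (hD0 _)]
        have h1 := hB2 i k hi x
        have h2 : D (i + 1) * ‖iteratedFDeriv ℝ k (u i) x‖ ≤ D (i + 1) * B i := by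
          have := hD0 (i + 1)
          gcongr
        rw [hDs] at h2
        have := hDg 0 i
        rw [add_zero] at this
        linarith
      · exact ((hu i).of_le (by exact_mod_cast le_top)).contDiffAt
  refine ⟨fun k => D (k + 1), T, fun k => hD0 _, ?_, hT0, ?_, hTrec, ?_⟩
  · refine squeeze_zero (fun k => (hD0 _).le) (g := fun k => D 0 * (1/4) ^ (k + 1)) ?_ ?_
    · intro k; simpa using hDg 0 (k + 1)
    · have := (tendsto_pow_atTop_nhds_zero_of_lt_one (r := (1:ℝ)/4) (by norm_num) (by norm_num))
      have := ((Filter.tendsto_add_atTop_iff_nat 1).2 this).const_mul (D 0)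
      simpa using this
  · intro k
    induction k with
    | zero => exact hT0.continuous
    | succ k ih =>
      have : T (k + 1) = fun x => T k x - (D (k + 1) : ℂ) * u k x := by
        funext x; rw [hTrec k x]; ring
      rw [this]
      exact ih.sub (continuous_const.mul (hu k).continuous)
  · intro k x
    have h1 : ‖T (k + 1) x‖ ≤ ∑' j : ℕ, D (k + 1) / 4 * (1/4) ^ j := by
      refine tsum_of_norm_bounded (hgs.mul_left _).hasSum ?_
      intro j
      have := hDg (k + 1) j
      have := hfn (j + (k + 1)) x
      linarith
    rw [tsum_mul_left, tsum_geometric_of_lt_one (by norm_num) (by norm_num)] at h1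
    have := hD0 (k + 1)
    norm_num at h1
    linarith

section SetupPeak

variable {X : Type*} [MetricSpace X] [CompactSpace X] {A : Subalgebra ℂ C(X, ℂ)}
    {K : Set X} {S : Set C(X, ℂ)} {Z W V : C(X, ℂ)} {T u : ℕ → C(X, ℂ)} {c s : ℕ → ℝ}
    {P : ℕ → Polynomial ℂ}

lemma AuxSetup.eval_all (h : AuxSetup A K S Z W V T u c s P) (φ : A →ₐ[ℂ] ℂ) :
    ∃ x : X, ∀ G : A, φ G = (G : C(X, ℂ)) x := by
  by_cases hφ : CharOn h.hA0 φ
  · obtain ⟨x, _, hx⟩ := h.char φ hφ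
    exact ⟨x, hx⟩
  · exact aux_char_offK h.hA0 φ hφ

lemma aux_ball_strict (z w z' w' : ℂ) (h : ‖z‖ ^ 2 + ‖w‖ ^ 2 = 1) (h' : ‖z'‖ ^ 2 + ‖w'‖ ^ 2 = 1) :
    ‖(1 + ((starRingEnd ℂ) z * z' + (starRingEnd ℂ) w * w')) / 2‖ ≤ 1 ∧
    (¬ (z' = z ∧ w' = w) → ‖(1 + ((starRingEnd ℂ) z * z' + (starRingEnd ℂ) w * w')) / 2‖ < 1) := by
  set a := (starRingEnd ℂ) z * z' + (starRingEnd ℂ) w * w' with ha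
  have h1 : ‖a‖ ≤ 1 := by
    have e1 := norm_add_le ((starRingEnd ℂ) z * z') ((starRingEnd ℂ) w * w')
    rw [norm_mul, norm_mul, RCLike.norm_conj, RCLike.norm_conj, ← ha] at e1
    nlinarith [sq_nonneg (‖z‖ - ‖z'‖), sq_nonneg (‖w‖ - ‖w'‖)]
  have h2 : ‖z' - z‖ ^ 2 + ‖w' - w‖ ^ 2 = 2 - 2 * a.re := by
    simp only [Complex.sq_norm, Complex.normSq_apply] at h h' ⊢
    simp only [ha, Complex.add_re, Complex.mul_re, Complex.conj_re, Complex.conj_im, Complex.sub_re,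
      Complex.sub_im]
    linear_combination h + h'
  have h3 : ‖1 + a‖ ^ 2 = 1 + 2 * a.re + ‖a‖ ^ 2 := by
    simp only [Complex.sq_norm, Complex.normSq_apply, Complex.add_re, Complex.add_im, Complex.one_re,
      Complex.one_im]
    ring
  have h5 : ‖(1 + a) / 2‖ = ‖1 + a‖ / 2 := by rw [norm_div]; norm_num
  rw [h5]
  constructor
  · have := norm_add_le (1 : ℂ) a
    rw [norm_one] at this
    linarith
  · intro hne
    have h4 : 0 < ‖z' - z‖ ^ 2 + ‖w' - w‖ ^ 2 := by
      by_contra hcon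
      apply hne
      have q1 : ‖z' - z‖ ^ 2 = 0 := by nlinarith [sq_nonneg ‖z' - z‖, sq_nonneg ‖w' - w‖]
      have q2 : ‖w' - w‖ ^ 2 = 0 := by nlinarith [sq_nonneg ‖z' - z‖, sq_nonneg ‖w' - w‖]
      exact ⟨sub_eq_zero.1 (norm_eq_zero.1 (pow_eq_zero_iff (two_ne_zero) |>.1 q1)),
        sub_eq_zero.1 (norm_eq_zero.1 (pow_eq_zero_iff (two_ne_zero) |>.1 q2))⟩
    nlinarith [norm_nonneg a, norm_nonneg (1 + a)]

lemma AuxSetup.peak (h : AuxSetup A K S Z W V T u c s P) (ρ : C(X, ℝ)) (hρ : ∀ x, 0 ≤ ρ x)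
    (hρ0 : ∀ x, ρ x = 0 ↔ x ∈ K) (hsep : ∀ x ∈ K, ∀ y ∈ K, Z x = Z y → W x = W y → x = y) (p : X) :
    ∃ g ∈ A, g p = 1 ∧ ∀ q : X, q ≠ p → ‖g q‖ < 1 := by
  by_cases hp : p ∈ K
  · let U : C(X, ℂ) := (1/2 : ℂ) • (1 + ((starRingEnd ℂ (Z p)) • Z + (starRingEnd ℂ (W p)) • W))
    have hUA : U ∈ A := A.smul_mem (A.add_mem A.one_mem (A.add_mem (A.smul_mem h.hZ _)
      (A.smul_mem h.hW _))) _
    have hUx : ∀ x, U x = (1 + ((starRingEnd ℂ) (Z p) * Z x + (starRingEnd ℂ) (W p) * W x)) / 2 := by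
      intro x
      simp only [U, ContinuousMap.smul_apply, ContinuousMap.add_apply, ContinuousMap.one_apply,
        smul_eq_mul]
      ring
    have hpos : ∀ x, 0 < max 1 ‖U x‖ * (1 + ρ x) := fun x => by
      have := hρ x
      have : 0 < max 1 ‖U x‖ := lt_max_of_lt_left one_pos
      positivity
    let F : C(X, ℂ) := ⟨fun x => U x * ((1 / (max 1 ‖U x‖ * (1 + ρ x)) : ℝ) : ℂ), by
      refine U.continuous.mul (Complex.continuous_ofReal.comp ?_)
      refine continuous_const.div ?_ (fun x => (hpos x).ne')
      exact (continuous_const.max U.continuous.norm).mul (continuous_const.add ρ.continuous)⟩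
    have hFK : ∀ x ∈ K, F x = U x := by
      intro x hx
      have h1 : ‖U x‖ ≤ 1 := by
        rw [hUx]; exact (aux_ball_strict _ _ _ _ (h.hsph p hp) (h.hsph x hx)).1
      have h2 := (hρ0 x).2 hx
      simp [F, h2, max_eq_left h1]
    refine ⟨F, aux_mem_of_eqOn h.hA0 hUA hFK, ?_, ?_⟩
    · rw [hFK p hp, hUx, Complex.conj_mul', Complex.conj_mul']
      have := h.hsph p hp
      have h2 : ((‖Z p‖ : ℂ)) ^ 2 + (‖W p‖ : ℂ) ^ 2 = 1 := by exact_mod_cast this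
      rw [h2]; norm_num
    · intro q hq
      by_cases hqK : q ∈ K
      · rw [hFK q hqK, hUx]
        refine (aux_ball_strict _ _ _ _ (h.hsph p hp) (h.hsph q hqK)).2 ?_
        rintro ⟨h1, h2⟩
        exact hq (hsep q hqK p hp h1 h2)
      · have h1 : 0 < ρ q := lt_of_le_of_ne (hρ q) (fun hh => hqK ((hρ0 q).1 hh.symm))
        simp only [F, ContinuousMap.coe_mk, norm_mul, Complex.norm_real, Real.norm_eq_abs]
        rw [abs_of_pos (one_div_pos.2 (hpos q)), mul_one_div, div_lt_one (hpos q)]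
        have h2 : ‖U q‖ ≤ max 1 ‖U q‖ := le_max_right _ _
        have h3 : 1 ≤ max 1 ‖U q‖ := le_max_left _ _
        nlinarith
  · have hρp : 0 < ρ p := lt_of_le_of_ne (hρ p) (fun hh => hp ((hρ0 p).1 hh.symm))
    let F : C(X, ℂ) := ⟨fun x => ((min 1 (ρ x / ρ p) * (1 / (1 + dist x p)) : ℝ) : ℂ), by
      refine Complex.continuous_ofReal.comp ?_
      refine (continuous_const.min (ρ.continuous.div_const _)).mul ?_
      refine continuous_const.div (continuous_const.add (continuous_id.dist continuous_const)) ?_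
      intro x
      have := dist_nonneg (x := x) (y := p)
      positivity⟩
    refine ⟨F, h.hA0 F ?_, ?_, ?_⟩
    · intro x hx
      simp [F, (hρ0 x).2 hx]
    · simp [F, hρp.ne']
    · intro q hq
      have h1 : 0 < dist q p := dist_pos.2 hq
      have h2 : 0 ≤ min 1 (ρ q / ρ p) := le_min zero_le_one (div_nonneg (hρ q) hρp.le)
      have h3 : min 1 (ρ q / ρ p) ≤ 1 := min_le_left _ _
      simp only [F, ContinuousMap.coe_mk, Complex.norm_real, Real.norm_eq_abs]
      rw [abs_of_nonneg (by positivity), mul_one_div, div_lt_one (by positivity)]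
      linarith

end SetupPeak

lemma aux_quot {E : Type*} [NormedAddCommGroup E] [NormedSpace ℝ E] (g : E → ℂ) (ρ : E → ℝ)
    (hg : ContDiff ℝ (⊤ : ℕ∞) g) (hρ : ContDiff ℝ (⊤ : ℕ∞) ρ) (hnn : ∀ x, 0 ≤ ρ x)
    (h0 : ∀ x, ρ x = 0 → g x ≠ 0) :
    ContDiff ℝ (⊤ : ℕ∞) (fun x => (starRingEnd ℂ) (g x) * (((‖g x‖ ^ 2 + ρ x)⁻¹ : ℝ) : ℂ)) := by
  have hd : ContDiff ℝ (⊤ : ℕ∞) (fun x => (‖g x‖ ^ 2 + ρ x)⁻¹) := by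
    refine ContDiff.inv ((hg.norm_sq ℝ).add hρ) ?_
    intro x
    by_cases hx : ρ x = 0
    · have := norm_pos_iff.2 (h0 x hx)
      rw [hx]; positivity
    · have : 0 < ρ x := lt_of_le_of_ne (hnn x) (Ne.symm hx)
      positivity
  exact (Complex.conjCLE.contDiff.comp hg).mul (Complex.ofRealCLM.contDiff.comp hd)

lemma aux_quot_mul (z : ℂ) (hz : z ≠ 0) : (starRingEnd ℂ) z * (((‖z‖ ^ 2 + 0)⁻¹ : ℝ) : ℂ) * z = 1 := by
  have h1 : (starRingEnd ℂ) z * z = (‖z‖ : ℂ) ^ 2 := Complex.conj_mul' z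
  have h2 : (‖z‖ : ℂ) ≠ 0 := by exact_mod_cast (norm_pos_iff.2 hz).ne'
  push_cast
  rw [mul_right_comm, h1, add_zero]
  field_simp

theorem stmt7 {n : ℕ} (hn : 2 ≤ n) (Ω : Set (Fin n → ℂ)) (hne : Ω.Nonempty)
    (hopen : IsOpen Ω) (hbd : Bornology.IsBounded Ω) :
    ∃ N : ℕ, ∃ f : Fin N → (Fin n → ℂ) → ℂ, (∀ j, ContDiff ℝ (⊤ : ℕ∞) (f j)) ∧
      ∃ K : Set (Fin n → ℂ), ∃ hKΩ : K ⊆ Ω, IsCompact K ∧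
        -- (1) the graph of f over Ω̄ is polynomially convex
        polyHull (graphSet f (closure Ω)) = graphSet f (closure Ω) ∧
        -- (2') every point of Ω̄ is a peak point for [z,f]_Ω̄
        (∀ p : closure Ω, ∃ g ∈ genAlg (zhGens (closure Ω) f),
          g p = 1 ∧ ∀ q : closure Ω, q ≠ p → ‖g q‖ < 1) ∧
        -- (3) C(Ω̄) ∩ R(K) ⊆ [z,f]_Ω̄
        (∀ F : C(closure Ω, ℂ),
          F.comp ⟨Set.inclusion (hKΩ.trans subset_closure),
            continuous_inclusion (hKΩ.trans subset_closure)⟩ ∈ ratAlg K →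
          F ∈ genAlg (zhGens (closure Ω) f)) ∧
        -- (4) [z,f]_Ω̄ ≠ C(Ω̄)
        genAlg (zhGens (closure Ω) f) ≠ Set.univ := by
  obtain ⟨P, s, hs, hP1, hP2, hd⟩ := aux_cheese
  obtain ⟨p, hp⟩ := hne
  obtain ⟨t, ht, htΩ⟩ := Metric.nhds_basis_closedBall.mem_iff.1 (hopen.mem_nhds hp)
  have htc : (t : ℂ) ≠ 0 := by exact_mod_cast ht.ne'
  let i0 : Fin n := ⟨0, by omega⟩
  let i1 : Fin n := ⟨1, by omega⟩
  have hi01 : i1 ≠ i0 := by simp [i0, i1]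
  let Z0 : (Fin n → ℂ) → ℂ := fun x => (x i0 - p i0) / t
  let W0 : (Fin n → ℂ) → ℂ := fun x => (x i1 - p i1) / t
  have hZ0 : ContDiff ℝ (⊤ : ℕ∞) Z0 := ((contDiff_apply ℝ ℂ i0).sub contDiff_const).div_const _
  have hW0 : ContDiff ℝ (⊤ : ℕ∞) W0 := ((contDiff_apply ℝ ℂ i1).sub contDiff_const).div_const _
  let K : Set (Fin n → ℂ) := {x | ‖Z0 x‖ ≤ 1/2 ∧ (∀ k, s k ≤ ‖(P k).eval (Z0 x)‖) ∧
    ‖Z0 x‖ ^ 2 + ‖W0 x‖ ^ 2 = 1 ∧ ∀ i, i ≠ i0 → i ≠ i1 → x i = p i}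
  have hKb : K ⊆ closedBall p t := by
    rintro x ⟨h1, h2, h3, h4⟩
    rw [mem_closedBall, dist_pi_le_iff ht.le]
    intro i
    rw [dist_eq_norm]
    by_cases hi : i = i0
    · have : x i - p i = t * Z0 x := by simp only [Z0, hi]; field_simp
      rw [this, norm_mul, Complex.norm_real, Real.norm_eq_abs, abs_of_pos ht]
      nlinarith [norm_nonneg (Z0 x)]
    by_cases hi' : i = i1
    · have : x i - p i = t * W0 x := by simp only [W0, hi']; field_simp
      rw [this, norm_mul, Complex.norm_real, Real.norm_eq_abs, abs_of_pos ht]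
      have : ‖W0 x‖ ≤ 1 := by nlinarith [norm_nonneg (W0 x), sq_nonneg ‖Z0 x‖]
      nlinarith
    · rw [h4 i hi hi']; simp [ht.le]
  have hKcl : IsClosed K := by
    have e : K = {x | ‖Z0 x‖ ≤ 1/2} ∩ ((⋂ k, {x | s k ≤ ‖(P k).eval (Z0 x)‖}) ∩
      ({x | ‖Z0 x‖ ^ 2 + ‖W0 x‖ ^ 2 = 1} ∩ ⋂ i, ⋂ (_ : i ≠ i0), ⋂ (_ : i ≠ i1), {x | x i = p i})) := by
      ext x; simp [K]
    rw [e]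
    have cZ := hZ0.continuous
    have cW := hW0.continuous
    refine (isClosed_le cZ.norm continuous_const).inter ((isClosed_iInter fun k => ?_).inter
      ((isClosed_eq ((cZ.norm.pow 2).add (cW.norm.pow 2)) continuous_const).inter
      (isClosed_iInter fun i => isClosed_iInter fun _ => isClosed_iInter fun _ => ?_)))
    · exact isClosed_le continuous_const ((P k).continuous.comp cZ).norm
    · exact isClosed_eq (continuous_apply i) continuous_const
  have hKc : IsCompact K := (isCompact_closedBall p t).of_isClosed_subset hKcl hKb
  have hKΩ : K ⊆ Ω := hKb.trans htΩ
  obtain ⟨ρ, hρsupp, hρd, hρr⟩ := (hKcl.isOpen_compl).exists_contDiff_support_eq (n := ⊤)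
  have hρnn : ∀ x, 0 ≤ ρ x := fun x => (hρr ⟨x, rfl⟩).1
  have hρ0 : ∀ x, ρ x = 0 ↔ x ∈ K := by
    intro x
    have : x ∈ Function.support ρ ↔ x ∈ Kᶜ := by rw [hρsupp]
    rw [Function.mem_support, Set.mem_compl_iff, not_iff_not] at this
    exact this
  obtain ⟨R, hR⟩ := (hbd.closure).subset_closedBall (0 : Fin n → ℂ)
  let η : ContDiffBump (0 : Fin n → ℂ) := ⟨|R| + 1, |R| + 2, by positivity, by linarith⟩
  have hη1 : ∀ x ∈ closure Ω, η x = 1 := by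
    intro x hx
    apply η.one_of_mem_closedBall
    exact closedBall_subset_closedBall (by have := le_abs_self R; change R ≤ |R| + 1; linarith) (hR hx)
  let qf : ((Fin n → ℂ) → ℂ) → (Fin n → ℂ) → ℂ := fun g x =>
    (starRingEnd ℂ) (g x) * (((‖g x‖ ^ 2 + ρ x)⁻¹ : ℝ) : ℂ)
  have hPne : ∀ x ∈ K, ∀ k, (P k).eval (Z0 x) ≠ 0 := fun x hx k =>
    norm_pos_iff.1 ((hs k).trans_le (hx.2.1 k))
  have hWne : ∀ x ∈ K, W0 x ≠ 0 := by
    intro x hx h0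
    have h1 := hx.2.2.1
    have h2 := hx.1
    rw [h0, norm_zero] at h1
    nlinarith [norm_nonneg (Z0 x)]
  let u0 : ℕ → (Fin n → ℂ) → ℂ := fun k x => (η x : ℂ) * qf (fun x => (P k).eval (Z0 x)) x
  have hu0 : ∀ k, ContDiff ℝ (⊤ : ℕ∞) (u0 k) := by
    intro k
    refine (Complex.ofRealCLM.contDiff.comp η.contDiff).mul (aux_quot _ _ ?_ hρd hρnn ?_)
    · have h1 : ContDiff ℂ (⊤ : ℕ∞) (fun z : ℂ => (P k).eval z) := by
        simpa using (P k).contDiff_aeval (𝕜 := ℂ) (⊤ : ℕ∞)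
      exact (h1.restrict_scalars ℝ).comp hZ0
    · exact fun x hx => hPne x ((hρ0 x).1 hx) k
  have hu0s : ∀ k, HasCompactSupport (u0 k) := by
    intro k
    apply HasCompactSupport.mul_right
    exact η.hasCompactSupport.comp_left (g := fun r : ℝ => (r : ℂ)) (by simp)
  obtain ⟨c, T0, hc, hclim, hT0d, hT0c, hTrec, hTn⟩ := aux_series u0 hu0 hu0s
  have hV0 : ContDiff ℝ (⊤ : ℕ∞) (qf W0) :=
    aux_quot _ _ hW0 hρd hρnn (fun x hx => hWne x ((hρ0 x).1 hx))
  let f : Fin (n + 3) → (Fin n → ℂ) → ℂ :=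
    Fin.append (fun (i : Fin n) x => (ρ x : ℂ) * (starRingEnd ℂ) (x i))
      ![fun x => (ρ x : ℂ), qf W0, T0 0]
  have hρC : ContDiff ℝ (⊤ : ℕ∞) (fun x => (ρ x : ℂ)) := Complex.ofRealCLM.contDiff.comp hρd
  have hf1 : ∀ i : Fin n, f (Fin.castAdd 3 i) = fun x => (ρ x : ℂ) * (starRingEnd ℂ) (x i) :=
    fun i => Fin.append_left _ _ i
  have hf2 : f (Fin.natAdd n 0) = fun x => (ρ x : ℂ) := Fin.append_right _ _ 0
  have hf3 : f (Fin.natAdd n 1) = qf W0 := Fin.append_right _ _ 1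
  have hf4 : f (Fin.natAdd n 2) = T0 0 := Fin.append_right _ _ 2
  have hfd : ∀ j, ContDiff ℝ (⊤ : ℕ∞) (f j) := by
    intro j
    induction j using Fin.addCases with
    | left i =>
      rw [hf1]
      exact hρC.mul (Complex.conjCLE.contDiff.comp (contDiff_apply ℝ ℂ i))
    | right i =>
      fin_cases i
      · exact hf2 ▸ hρC
      · exact hf3 ▸ hV0
      · exact hf4 ▸ hT0d
  clear_value f
  have hXc : IsCompact (closure Ω) := hbd.isCompact_closure
  have : CompactSpace (closure Ω) := isCompact_iff_compactSpace.1 hXc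
  let res : (g : (Fin n → ℂ) → ℂ) → Continuous g → C(closure Ω, ℂ) := fun g hg =>
    ⟨fun x => g x, hg.comp continuous_subtype_val⟩
  let e : Fin n → C(closure Ω, ℂ) := fun i => res (fun x => x i) (continuous_apply i)
  let F : Fin (n + 3) → C(closure Ω, ℂ) := fun j => res (f j) (hfd j).continuous
  set S := zhGens (closure Ω) f with hS
  have heS : ∀ i, e i ∈ S := fun i => Or.inl ⟨i, fun z => rfl⟩
  have hFS : ∀ j, F j ∈ S := fun j => Or.inr ⟨j, fun z => rfl⟩
  set A : Subalgebra ℂ C(closure Ω, ℂ) := (Algebra.adjoin ℂ S).topologicalClosure with hA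
  have hSA : S ⊆ A := Algebra.subset_adjoin.trans (Subalgebra.le_topologicalClosure _)
  have hAc : IsClosed (A : Set C(closure Ω, ℂ)) := Subalgebra.isClosed_topologicalClosure _
  have hgA : genAlg S = (A : Set C(closure Ω, ℂ)) := rfl
  let Z : C(closure Ω, ℂ) := res Z0 hZ0.continuous
  let W : C(closure Ω, ℂ) := res W0 hW0.continuous
  let V : C(closure Ω, ℂ) := res (qf W0) hV0.continuous
  let T : ℕ → C(closure Ω, ℂ) := fun k => res (T0 k) (hT0c k)
  let u : ℕ → C(closure Ω, ℂ) := fun k => res (u0 k) (hu0 k).continuous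
  let K' : Set (closure Ω) := Subtype.val ⁻¹' K
  have hset : AuxSetup A K' S Z W V T u c s P :=
    { hA := rfl
      hA0 := by
        intro G hG
        have e2 : F (Fin.natAdd n 0) ∈ A := hSA (hFS _)
        have e3 : ∀ x, F (Fin.natAdd n 0) x = (ρ x : ℂ) := fun x => congrFun hf2 x
        refine aux_sw A hAc (F (Fin.natAdd n 0)) e K' ?_ ?_ e2 ?_ ?_ ?_ G hG
        · intro x hx
          rw [e3] at hx
          exact (hρ0 x).1 (by exact_mod_cast hx)
        · ext x
          change star (F (Fin.natAdd n 0) x) = _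
          rw [e3]
          exact Complex.conj_ofReal _
        · exact fun i => A.mul_mem e2 (hSA (heS i))
        · intro i
          have : F (Fin.natAdd n 0) * star (e i) = F (Fin.castAdd 3 i) := by
            ext x
            rw [ContinuousMap.mul_apply, e3]
            exact (congrFun (hf1 i) x).symm
          rw [this]
          exact hSA (hFS _)
        · intro x y hxy
          exact Subtype.ext (funext hxy)
      hZ := by
        have : Z = (t : ℂ)⁻¹ • (e i0 - algebraMap ℂ _ (p i0)) := by
          ext x
          exact div_eq_inv_mul _ _
        rw [this]
        exact A.smul_mem (A.sub_mem (hSA (heS _)) (A.algebraMap_mem _)) _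
      hW := by
        have : W = (t : ℂ)⁻¹ • (e i1 - algebraMap ℂ _ (p i1)) := by
          ext x
          exact div_eq_inv_mul _ _
        rw [this]
        exact A.smul_mem (A.sub_mem (hSA (heS _)) (A.algebraMap_mem _)) _
      hV := hSA (Or.inr ⟨Fin.natAdd n 1, fun z => by rw [hf3]; rfl⟩)
      hT0 := hSA (Or.inr ⟨Fin.natAdd n 2, fun z => by rw [hf4]; rfl⟩)
      hVW := by
        intro x hx
        have h1 := aux_quot_mul (W0 x) (hWne x hx)
        change (starRingEnd ℂ) (W0 x) * (((‖W0 x‖ ^ 2 + ρ x)⁻¹ : ℝ) : ℂ) * W0 x = 1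
        rw [(hρ0 x).2 hx]
        exact h1
      hc := hc
      hclim := hclim
      hT := fun k x _ => hTrec k x
      hTn := fun k x _ => hTn k x
      hu := by
        intro k x hx
        have h1 := aux_quot_mul _ (hPne x hx k)
        change (η x : ℂ) * ((starRingEnd ℂ) ((P k).eval (Z0 x)) *
          (((‖(P k).eval (Z0 x)‖ ^ 2 + ρ x)⁻¹ : ℝ) : ℂ)) * (P k).eval (Z0 x) = 1
        rw [(hρ0 x).2 hx, hη1 x x.2, Complex.ofReal_one, one_mul]
        exact h1
      hs := hs
      hP1 := hP1
      hP2 := hP2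
      hZE := fun x hx => hx.1
      hZs := fun x hx => hx.2.1
      hsph := fun x hx => hx.2.2.1
      hsurj := by
        intro z w hz1 hz2 hzw
        let y : Fin n → ℂ := fun i => if i = i0 then p i0 + t * z else if i = i1 then p i1 + t * w else p i
        have hyZ : Z0 y = z := by simp [Z0, y, htc]
        have hyW : W0 y = w := by simp [W0, y, htc, hi01]
        have hyK : y ∈ K := by
          refine ⟨by rw [hyZ]; exact hz1, by rw [hyZ]; exact hz2, by rw [hyZ, hyW]; exact hzw, ?_⟩
          intro i h1 h2
          simp [y, h1, h2]
        exact ⟨⟨y, subset_closure (hKΩ hyK)⟩, hyK, hyZ, hyW⟩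
      hgen := by
        rintro g (⟨i, hi⟩ | ⟨j, hj⟩)
        · by_cases h0 : i = i0
          · refine ⟨algebraMap ℂ _ (p i0) + (t : ℂ) • Z, Subalgebra.add_mem _ (Subalgebra.algebraMap_mem _ _)
              (Subalgebra.smul_mem _ (Algebra.subset_adjoin (by simp)) _), fun x hx => ?_⟩
            rw [hi, h0]
            change (x : Fin n → ℂ) i0 = p i0 + t * (((x : Fin n → ℂ) i0 - p i0) / t)
            field_simp
            ring
          by_cases h1 : i = i1
          · refine ⟨algebraMap ℂ _ (p i1) + (t : ℂ) • W, Subalgebra.add_mem _ (Subalgebra.algebraMap_mem _ _)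
              (Subalgebra.smul_mem _ (Algebra.subset_adjoin (by simp)) _), fun x hx => ?_⟩
            rw [hi, h1]
            change (x : Fin n → ℂ) i1 = p i1 + t * (((x : Fin n → ℂ) i1 - p i1) / t)
            field_simp
            ring
          · refine ⟨algebraMap ℂ _ (p i), Subalgebra.algebraMap_mem _ _, fun x hx => ?_⟩
            rw [hi]
            exact hx.2.2.2 i h0 h1
        · induction j using Fin.addCases with
          | left i =>
            refine ⟨0, Subalgebra.zero_mem _, fun x hx => ?_⟩
            rw [hj, hf1]
            simp [(hρ0 x).2 hx]
          | right i =>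
            fin_cases i
            · refine ⟨0, Subalgebra.zero_mem _, fun x hx => ?_⟩
              rw [hj]
              change f (Fin.natAdd n 0) _ = _
              rw [hf2]
              simp [(hρ0 x).2 hx]
            · refine ⟨V, Algebra.subset_adjoin (by simp), fun x hx => ?_⟩
              rw [hj]
              change f (Fin.natAdd n 1) _ = _
              rw [hf3]
              rfl
            · refine ⟨T 0, Algebra.subset_adjoin (by simp), fun x hx => ?_⟩
              rw [hj]
              change f (Fin.natAdd n 2) _ = _
              rw [hf4]
              rfl }
  refine ⟨n + 3, f, hfd, K, hKΩ, hKc, ?_, ?_, ?_, ?_⟩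
  · have hgc : Continuous (fun x : Fin n → ℂ => (Fin.append x (fun j => f j x) : Fin (n + (n + 3)) → ℂ)) := by
      refine continuous_pi fun i => ?_
      induction i using Fin.addCases with
      | left i => simpa using continuous_apply i
      | right i => simpa using (hfd i).continuous
    have hGc : IsCompact (graphSet f (closure Ω)) := hXc.image hgc
    apply Set.Subset.antisymm
    · intro y hy
      let g : Fin (n + (n + 3)) → C(closure Ω, ℂ) := fun i =>
        res (fun x => (Fin.append x (fun j => f j x) : Fin (n + (n + 3)) → ℂ) i)
          ((continuous_apply i).comp hgc)
      have hgS : Set.range g = S := by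
        ext G
        constructor
        · rintro ⟨i, rfl⟩
          induction i using Fin.addCases with
          | left i => exact Or.inl ⟨i, fun z => Fin.append_left (z : Fin n → ℂ) (fun j => f j z) i⟩
          | right i => exact Or.inr ⟨i, fun z => Fin.append_right (z : Fin n → ℂ) (fun j => f j z) i⟩
        · rintro (⟨i, hi⟩ | ⟨j, hj⟩)
          · refine ⟨Fin.castAdd _ i, ?_⟩
            ext x
            rw [hi]
            exact Fin.append_left (x : Fin n → ℂ) (fun j => f j x) i
          · refine ⟨Fin.natAdd _ j, ?_⟩
            ext x
            rw [hj]
            exact Fin.append_right (x : Fin n → ℂ) (fun j => f j x) j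
      have hgmem : ∀ i, g i ∈ A := fun i => hSA (hgS ▸ ⟨i, rfl⟩)
      obtain ⟨φ, hφ⟩ := aux_hull_char A g (by rw [hgS]) hgmem y (by
        intro q C hC hq
        refine (hy q).trans (Real.sSup_le ?_ hC)
        rintro _ ⟨_, ⟨x, hx, rfl⟩, rfl⟩
        exact hq ⟨x, hx⟩)
      obtain ⟨x, hx⟩ := hset.eval_all φ
      refine ⟨x, x.2, ?_⟩
      funext i
      rw [← hφ i, hx]
      rfl
    · intro y hy q
      refine le_csSup ?_ ⟨y, hy, rfl⟩
      exact (hGc.image (q.continuous_eval.norm)).bddAbove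
  · intro x
    refine hset.peak ⟨fun x => ρ x, hρd.continuous.comp continuous_subtype_val⟩ (fun x => hρnn x)
      (fun x => hρ0 x) ?_ x
    intro a ha b hb hZab hWab
    apply Subtype.ext
    funext i
    have hZab' : ((a : Fin n → ℂ) i0 - p i0) / t = ((b : Fin n → ℂ) i0 - p i0) / t := hZab
    have hWab' : ((a : Fin n → ℂ) i1 - p i1) / t = ((b : Fin n → ℂ) i1 - p i1) / t := hWab
    by_cases h0 : i = i0
    · rw [h0]; simpa [div_left_inj' htc] using hZab'
    by_cases h1 : i = i1
    · rw [h1]; simpa [div_left_inj' htc] using hWab'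
    · rw [ha.2.2.2 i h0 h1, hb.2.2.2 i h0 h1]
  · intro G hG
    have : CompactSpace K := isCompact_iff_compactSpace.1 hKc
    change G ∈ A
    apply aux_mem_of_approx hset.hA0 hAc
    intro ε hε
    obtain ⟨g, ⟨q1, q2, hq2, hg⟩, hdist⟩ := Metric.mem_closure_iff.1 hG ε hε
    let eA : Fin n → A := fun i => ⟨e i, hSA (heS i)⟩
    have hev : ∀ (q : MvPolynomial (Fin n) ℂ) (x : closure Ω),
        ((MvPolynomial.aeval eA q : A) : C(closure Ω, ℂ)) x = MvPolynomial.eval (x : Fin n → ℂ) q := by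
      intro q x
      have := MvPolynomial.map_aeval eA
        ((ContinuousMap.evalAlgHom ℂ ℂ x : C(closure Ω, ℂ) →ₐ[ℂ] ℂ).comp A.val).toRingHom q
      have h2 : (((ContinuousMap.evalAlgHom ℂ ℂ x : C(closure Ω, ℂ) →ₐ[ℂ] ℂ).comp A.val).toRingHom).comp
        (algebraMap ℂ A) = RingHom.id ℂ := by ext; rfl
      rw [h2] at this
      exact this
    obtain ⟨a, ha⟩ := aux_inv hset.hA0 hAc hset.char (MvPolynomial.aeval eA q2) (by
      intro x hx
      rw [hev]
      exact hq2 x hx)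
    refine ⟨_, (MvPolynomial.aeval eA q1 * a : A).2, fun x hx => ?_⟩
    have h1 := ContinuousMap.dist_apply_le_dist (f := G.comp ⟨Set.inclusion (hKΩ.trans subset_closure),
            continuous_inclusion (hKΩ.trans subset_closure)⟩) (g := g) (⟨x, hx⟩ : K)
    rw [dist_eq_norm, hg] at h1
    have h2 := ha x hx
    rw [hev] at h2
    have h3 : ((MvPolynomial.aeval eA q1 * a : A) : C(closure Ω, ℂ)) x =
        MvPolynomial.eval (x : Fin n → ℂ) q1 / MvPolynomial.eval (x : Fin n → ℂ) q2 := by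
      rw [MulMemClass.coe_mul, ContinuousMap.mul_apply, hev, div_eq_mul_inv,
        eq_inv_of_mul_eq_one_left h2]
    rw [h3]
    exact h1.trans hdist.le
  · intro huniv
    have h1 := hset.ne_top hd
    apply h1
    have : star Z ∈ genAlg S := by rw [huniv]; trivial
    exact this
end

section
/- Let K be a closed subset of the torus Γ. Suppose there exists c ∈ ℂ with |c| = 1 such that K is disjoint from the circle {(z_1,z_2) ∈ Γ : z_1 = c}, and that there is no a ∈ ℂ with |a| = 1 such that K contains the full circle {(z_1,z_2) ∈ Γ : z_1 = a}. Then [z_1,z_2]_K = C(K,ℂ); in particular, K is polynomially convex. -/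
/-- Generators of the algebra `[z₁,z₂]_M`: the coordinate functions. -/
def coordGens {m : ℕ} (M : Set (Fin m → ℂ)) : Set C(M, ℂ) :=
  {g | ∃ i : Fin m, ∀ z : M, g z = (z : Fin m → ℂ) i}

/-- The unit torus, the distinguished boundary of the bidisk. -/
def Torus : Set (Fin 2 → ℂ) := {z | ‖z 0‖ = 1 ∧ ‖z 1‖ = 1}

lemma aux_star_mem {X : Type*} [TopologicalSpace X] [CompactSpace X]
    (S : Subalgebra ℂ C(X, ℂ)) (hS : IsClosed (S : Set C(X, ℂ))) (f : C(X, ℂ)) (hf : f ∈ S)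
    (h1 : ∀ x, ‖f x‖ = 1) (d : ℂ) (hd : ‖d‖ = 1) (hfd : ∀ x, f x ≠ d) : star f ∈ S := by
  have hu : IsUnit (⟨f, hf⟩ : S) := by
    by_contra hnu
    have h0 : (0 : ℂ) ∈ spectrum ℂ (⟨f, hf⟩ : S) := (spectrum.zero_mem_iff ℂ).2 hnu
    have := hS
    have hb := Subalgebra.spectrum_isBounded_connectedComponentIn S (⟨f, hf⟩ : S) h0
    have hpre : IsPreconnected ((fun t : ℝ => (t : ℂ) * d) '' Set.Ici 0) :=
      isPreconnected_Ici.image _ (by fun_prop)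
    have hsub := hpre.subset_connectedComponentIn (x := 0)
      (F := (spectrum ℂ ((⟨f, hf⟩ : S) : C(X, ℂ)))ᶜ) ⟨0, by simp, by simp⟩ (by
        rintro _ ⟨t, ht, rfl⟩ hmem
        rw [ContinuousMap.spectrum_eq_range] at hmem
        obtain ⟨x, hx⟩ := hmem
        have hx' : f x = t * d := hx
        have hn := h1 x
        rw [hx', norm_mul, hd, mul_one, Complex.norm_real, Real.norm_of_nonneg ht] at hn
        apply hfd x
        rw [hx', hn]; simp)
    obtain ⟨R, hR⟩ := (hb.subset hsub).exists_norm_le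
    have := hR _ ⟨|R| + 1, by simp only [Set.mem_Ici]; positivity, rfl⟩
    rw [norm_mul, hd, mul_one, Complex.norm_real, Real.norm_of_nonneg (by positivity)] at this
    linarith [le_abs_self R]
  obtain ⟨g, hg⟩ := hu.exists_right_inv
  have hg' : f * (g : C(X, ℂ)) = 1 := congrArg Subtype.val hg
  have : star f = (g : C(X, ℂ)) := by
    have h2 : star f * f = 1 := by
      ext x
      simp [Complex.conj_mul', h1 x]
    calc star f = star f * (f * g) := by rw [hg', mul_one]
      _ = g := by rw [← mul_assoc, h2, one_mul]
  rw [this]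
  exact g.2

lemma aux_sphere_comp {Y : Type*} [TopologicalSpace Y] [CompactSpace Y]
    (S : Subalgebra ℂ C(Y, ℂ)) (hS : IsClosed (S : Set C(Y, ℂ)))
    (π : C(Y, Metric.sphere (0 : ℂ) 1))
    (h : (ContinuousMap.restrict (Metric.sphere (0 : ℂ) 1) (.id ℂ)).comp π ∈ S)
    (h' : star ((ContinuousMap.restrict (Metric.sphere (0 : ℂ) 1) (.id ℂ)).comp π) ∈ S)
    (φ : C(Metric.sphere (0 : ℂ) 1, ℂ)) : φ.comp π ∈ S := by
  induction φ using ContinuousMap.induction_on_of_compact with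
  | const r => exact S.algebraMap_mem r
  | id => exact h
  | star_id => exact h'
  | add f g hf hg => exact S.add_mem hf hg
  | mul f g hf hg => exact S.mul_mem hf hg
  | frequently f hf =>
    exact hf.mem_of_closed (s := {g : C(Metric.sphere (0 : ℂ) 1, ℂ) | g.comp π ∈ S})
      (hS.preimage (ContinuousMap.continuous_precomp π))

lemma aux_local {Y : Type*} [TopologicalSpace Y] [CompactSpace Y]
    (S : Subalgebra ℂ C(Y, ℂ)) (hS : IsClosed (S : Set C(Y, ℂ)))
    (f ψ : C(Y, ℂ)) (hf : f ∈ S) (hψ : ψ ∈ S) (h1 : ∀ x, ‖f x‖ = 1) (hψ1 : ∀ x, ‖ψ x‖ ≤ 1)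
    (L : Set Y) (hL : IsClosed L) (hψL : ∀ x ∉ L, ψ x = 0)
    (d : ℂ) (hd : ‖d‖ = 1) (hfd : ∀ x ∈ L, f x ≠ d) : ψ * star f ∈ S := by
  have : CompactSpace L := isCompact_iff_compactSpace.1 hL.isCompact
  have key := aux_star_mem (Algebra.elemental ℂ (f.restrict L)) (Algebra.elemental.isClosed ℂ (f.restrict L))
    (f.restrict L) (Algebra.elemental.self_mem ℂ (f.restrict L)) (fun x => h1 x) d hd (fun x => hfd x x.2)
  change star (f.restrict L) ∈ closure (Algebra.adjoin ℂ {f.restrict L} : Set C(L, ℂ)) at key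
  rw [← SetLike.mem_coe, ← hS.closure_eq, Metric.mem_closure_iff]
  intro ε hε
  obtain ⟨b, hb, hbd⟩ := Metric.mem_closure_iff.1 key ε hε
  rw [Algebra.adjoin_singleton_eq_range_aeval] at hb
  obtain ⟨q, rfl⟩ := hb
  refine ⟨ψ * Polynomial.aeval f q, S.mul_mem hψ (Algebra.adjoin_le (Set.singleton_subset_iff.2 hf) (Polynomial.aeval_mem_adjoin_singleton ℂ f)), ?_⟩
  rw [ContinuousMap.dist_lt_iff hε] at hbd ⊢
  intro x
  by_cases hx : x ∈ L
  · have := hbd ⟨x, hx⟩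
    rw [dist_eq_norm] at this ⊢
    have e : (Polynomial.aeval (f.restrict L) q : C(L, ℂ)) ⟨x, hx⟩ = (Polynomial.aeval f q) x := by
      simp [Polynomial.aeval_continuousMap_apply]
    change ‖star f x - (Polynomial.aeval (f.restrict L) q : C(L, ℂ)) ⟨x, hx⟩‖ < ε at this
    rw [e] at this
    calc ‖(ψ * star f) x - (ψ * Polynomial.aeval f q) x‖
        = ‖ψ x‖ * ‖star f x - Polynomial.aeval f q x‖ := by
          rw [← norm_mul]; congr 1; simp [mul_sub]
      _ ≤ 1 * ‖star f x - Polynomial.aeval f q x‖ := by gcongr; exact hψ1 x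
      _ < ε := by rw [one_mul]; exact this
  · simp [hψL x hx, hε]

lemma aux_hull {m : ℕ} (K : Set (Fin m → ℂ)) (hK : IsCompact K)
    (h : genAlg (coordGens K) = Set.univ) : polyHull K = K := by
  have : CompactSpace K := isCompact_iff_compactSpace.1 hK
  let X : Fin m → C(K, ℂ) := fun i => ⟨fun z => (z : Fin m → ℂ) i, (continuous_apply i).comp continuous_subtype_val⟩
  have hX : coordGens K = Set.range X := by
    ext g
    constructor
    · rintro ⟨i, hi⟩; exact ⟨i, by ext z; exact (hi z).symm⟩
    · rintro ⟨i, rfl⟩; exact ⟨i, fun z => rfl⟩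
  have hev : ∀ (p : MvPolynomial (Fin m) ℂ) (z : K),
      (MvPolynomial.aeval X p) z = MvPolynomial.eval (z : Fin m → ℂ) p := by
    intro p z
    induction p using MvPolynomial.induction_on with
    | C a => simp
    | add p q hp hq => simp [hp, hq]
    | mul_X p i hp => simp [hp, X]
  have hdense : ∀ g : C(K, ℂ), ∀ ε > 0, ∃ p : MvPolynomial (Fin m) ℂ,
      dist g (MvPolynomial.aeval X p) < ε := by
    intro g ε hε
    have hg : g ∈ genAlg (coordGens K) := h ▸ Set.mem_univ g
    rw [genAlg, hX, Algebra.adjoin_range_eq_range_aeval] at hg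
    obtain ⟨b, ⟨p, rfl⟩, hb⟩ := Metric.mem_closure_iff.1 hg ε hε
    exact ⟨p, hb⟩
  apply Set.Subset.antisymm
  · intro z hz
    by_contra hzK
    let F : C(K, ℂ) := ∑ i, (X i - ContinuousMap.const K (z i)) * star (X i - ContinuousMap.const K (z i))
    have hF : ∀ w, F w = ((∑ i, ‖(w : Fin m → ℂ) i - z i‖ ^ 2 : ℝ) : ℂ) := by
      intro w
      simp [F, X, ContinuousMap.sum_apply, Complex.mul_conj', ← map_sub]
    have hF0 : ∀ w, F w ≠ 0 := by
      intro w hw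
      rw [hF, Complex.ofReal_eq_zero, Finset.sum_eq_zero_iff_of_nonneg (by intros; positivity)] at hw
      apply hzK
      have : (w : Fin m → ℂ) = z := by
        ext i
        have := hw i (Finset.mem_univ i)
        simpa [sub_eq_zero] using this
      rw [← this]; exact w.2
    let G : C(K, ℂ) := ⟨fun w => (F w)⁻¹, F.continuous.inv₀ hF0⟩
    obtain ⟨C, hC0, hC⟩ : ∃ C : ℝ, 0 < C ∧ ∀ i, ‖X i - ContinuousMap.const K (z i)‖ ≤ C := by
      refine ⟨1 + ∑ i, ‖X i - ContinuousMap.const K (z i)‖, by positivity, fun i => ?_⟩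
      have := Finset.single_le_sum (f := fun i => ‖X i - ContinuousMap.const K (z i)‖)
        (fun i _ => norm_nonneg _) (Finset.mem_univ i)
      linarith
    choose p hp using fun i => hdense (star (X i - ContinuousMap.const K (z i)) * G)
      (1 / (2 * C * (m + 1))) (by positivity)
    have := hz (1 - ∑ i, (MvPolynomial.X i - MvPolynomial.C (z i)) * p i)
    have h1 : MvPolynomial.eval z (1 - ∑ i, (MvPolynomial.X i - MvPolynomial.C (z i)) * p i) = 1 := by
      simp
    rw [h1, norm_one] at this
    have h2 : sSup ((fun w => ‖MvPolynomial.eval w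
        (1 - ∑ i, (MvPolynomial.X i - MvPolynomial.C (z i)) * p i)‖) '' K) ≤ 1 / 2 := by
      apply Real.sSup_le _ (by norm_num)
      rintro _ ⟨w, hw, rfl⟩
      have e : MvPolynomial.eval w (1 - ∑ i, (MvPolynomial.X i - MvPolynomial.C (z i)) * p i)
          = (∑ i, (X i - ContinuousMap.const K (z i)) *
            (star (X i - ContinuousMap.const K (z i)) * G - MvPolynomial.aeval X (p i))) ⟨w, hw⟩ := by
        have e1 : (∑ i, (X i - ContinuousMap.const K (z i)) *
            (star (X i - ContinuousMap.const K (z i)) * G - MvPolynomial.aeval X (p i)))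
            = F * G - ∑ i, (X i - ContinuousMap.const K (z i)) * MvPolynomial.aeval X (p i) := by
          simp only [F, Finset.sum_mul, mul_sub, Finset.sum_sub_distrib, mul_assoc]
        have e2 : F * G = 1 := by
          ext w; simp [G, hF0 w]
        rw [e1, e2]
        simp [ContinuousMap.sum_apply, hev, X]
      simp only [e]
      refine (ContinuousMap.norm_coe_le_norm _ _).trans ?_
      calc _ ≤ ∑ i : Fin m, C * (1 / (2 * C * (m + 1))) := by
            refine norm_sum_le_of_le _ fun i _ => ?_
            refine (norm_mul_le _ _).trans ?_
            have := hp i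
            rw [dist_eq_norm] at this
            gcongr
            exact hC i
        _ = (m / (m + 1)) * (1 / 2) := by
            simp; field_simp
        _ ≤ 1 * (1 / 2) := by
            gcongr
            rw [div_le_one (by positivity)]; linarith
        _ = 1 / 2 := by norm_num
    linarith
  · intro z hz p
    apply le_csSup
    · exact (hK.image (MvPolynomial.continuous_eval p).norm).bddAbove
    · exact ⟨z, hz, rfl⟩

theorem stmt10 (K : Set (Fin 2 → ℂ)) (hKΓ : K ⊆ Torus) (hcl : IsClosed K)
    (hdisj : ∃ c : ℂ, ‖c‖ = 1 ∧ ∀ z ∈ K, z 0 ≠ c)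
    (hnc : ¬ ∃ a : ℂ, ‖a‖ = 1 ∧ {z ∈ Torus | z 0 = a} ⊆ K) :
    genAlg (coordGens K) = Set.univ ∧ polyHull K = K := by
  have hK : IsCompact K := by
    refine Metric.isCompact_of_isClosed_isBounded hcl ?_
    refine (Metric.isBounded_closedBall (x := (0 : Fin 2 → ℂ)) (r := 1)).subset fun z hz => ?_
    rw [mem_closedBall_zero_iff, pi_norm_le_iff_of_nonneg zero_le_one]
    intro i
    fin_cases i
    · exact (hKΓ hz).1.le
    · exact (hKΓ hz).2.le
  have : CompactSpace K := isCompact_iff_compactSpace.1 hK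
  suffices h : genAlg (coordGens K) = Set.univ from ⟨h, aux_hull K hK h⟩
  let X : Fin 2 → C(K, ℂ) := fun i => ⟨fun z => (z : Fin 2 → ℂ) i, (continuous_apply i).comp continuous_subtype_val⟩
  let S : Subalgebra ℂ C(K, ℂ) := (Algebra.adjoin ℂ (coordGens K)).topologicalClosure
  have hS : IsClosed (S : Set C(K, ℂ)) := Subalgebra.isClosed_topologicalClosure _
  have hXS : ∀ i, X i ∈ S := fun i =>
    Subalgebra.le_topologicalClosure _ (Algebra.subset_adjoin ⟨i, fun z => rfl⟩)
  have hn0 : ∀ w, ‖X 0 w‖ = 1 := fun w => (hKΓ w.2).1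
  have hn1 : ∀ w, ‖X 1 w‖ = 1 := fun w => (hKΓ w.2).2
  obtain ⟨c, hc, hcK⟩ := hdisj
  have hs0 : star (X 0) ∈ S := aux_star_mem S hS (X 0) (hXS 0) hn0 c hc (fun w => hcK w w.2)
  let π : C(K, Metric.sphere (0 : ℂ) 1) :=
    ⟨fun w => ⟨X 0 w, by simpa using hn0 w⟩, by fun_prop⟩
  have hcomp : ∀ φ : C(Metric.sphere (0 : ℂ) 1, ℂ), φ.comp π ∈ S :=
    aux_sphere_comp S hS π (hXS 0) hs0
  let J : Ideal C(Metric.sphere (0 : ℂ) 1, ℂ) :=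
    { carrier := {φ | φ.comp π * star (X 1) ∈ S}
      zero_mem' := by
        simp
      add_mem' := by
        intro a b ha hb
        have := S.add_mem ha hb
        rw [← add_mul] at this
        exact this
      smul_mem' := by
        intro a b hb
        have := S.mul_mem (hcomp a) hb
        rw [← mul_assoc] at this
        exact this }
  have hJ : J = ⊤ := by
    by_contra hne
    obtain ⟨M, hM, hJM⟩ := Ideal.exists_le_maximal J hne
    obtain ⟨a, ha⟩ := ContinuousMap.setOfIdeal_eq_compl_singleton M
    have ha' : a ∉ ContinuousMap.setOfIdeal M := by rw [ha]; simp
    rw [ContinuousMap.notMem_setOfIdeal] at ha'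
    have han : ‖(a : ℂ)‖ = 1 := by simpa using a.2
    obtain ⟨z, ⟨hzT, hza⟩, hzK⟩ := Set.not_subset.1 (fun hh => hnc ⟨a, han, hh⟩)
    let s : Set (Metric.sphere (0 : ℂ) 1) := {u | ![(u : ℂ), z 1] ∈ K}
    have hs : IsClosed s := hcl.preimage (by
      refine continuous_pi fun i => ?_
      fin_cases i
      · exact continuous_subtype_val
      · exact continuous_const)
    have has : a ∉ s := by
      intro h
      apply hzK
      have : z = ![(a : ℂ), z 1] := by
        ext i; fin_cases i
        · exact hza
        · rfl
      rw [this]; exact h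
    obtain ⟨t, ht, htc, hts⟩ := exists_mem_nhds_isClosed_subset (hs.isOpen_compl.mem_nhds has)
    obtain ⟨φ, hφ0, hφ1, hφ⟩ := exists_continuous_zero_one_of_isClosed
      (s := (interior t)ᶜ) (t := {a}) isOpen_interior.isClosed_compl isClosed_singleton
      (by simpa using mem_interior_iff_mem_nhds.2 ht)
    let ψ : C(Metric.sphere (0 : ℂ) 1, ℂ) := ⟨fun u => (φ u : ℂ), by fun_prop⟩
    have hψJ : ψ ∈ J := by
      refine aux_local S hS (X 1) (ψ.comp π) (hXS 1) (hcomp ψ) hn1 (fun x => ?_)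
        (π ⁻¹' t) (htc.preimage π.continuous) (fun x hx => ?_) (z 1) hzT.2 (fun x hx hxz => ?_)
      · have := hφ (π x)
        simp only [ψ, ContinuousMap.comp_apply, ContinuousMap.coe_mk, Complex.norm_real]
        rw [Real.norm_of_nonneg this.1]; exact this.2
      · have : φ (π x) = 0 := hφ0 (fun h => hx (interior_subset (s := t) h))
        simp [ψ, this]
      · apply hts hx
        change ![(x : Fin 2 → ℂ) 0, z 1] ∈ K
        have : ![(x : Fin 2 → ℂ) 0, z 1] = x := by
          ext i; fin_cases i
          · rfl
          · exact hxz.symm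
        rw [this]; exact x.2
    have h0 := ha' (hJM hψJ)
    have h1 : φ a = 1 := hφ1 rfl
    simp [ψ, h1] at h0
  have hs1 : star (X 1) ∈ S := by
    have : (1 : C(Metric.sphere (0 : ℂ) 1, ℂ)) ∈ J := hJ ▸ Submodule.mem_top
    have h2 : (1 : C(Metric.sphere (0 : ℂ) 1, ℂ)).comp π * star (X 1) ∈ S := this
    have h3 : (1 : C(Metric.sphere (0 : ℂ) 1, ℂ)).comp π = 1 := rfl
    rwa [h3, one_mul] at h2
  let A := StarAlgebra.adjoin ℂ (Set.range X)
  have hA : A.topologicalClosure = ⊤ := by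
    apply ContinuousMap.starSubalgebra_topologicalClosure_eq_top_of_separatesPoints
    intro x y hxy
    obtain ⟨i, hi⟩ : ∃ i, (x : Fin 2 → ℂ) i ≠ (y : Fin 2 → ℂ) i := by
      by_contra! hcon
      exact hxy (Subtype.ext (funext hcon))
    exact ⟨X i, ⟨X i, StarAlgebra.subset_adjoin ℂ _ ⟨i, rfl⟩, rfl⟩, hi⟩
  have hAS : A.toSubalgebra ≤ S := by
    rw [StarAlgebra.adjoin_toSubalgebra]
    apply Algebra.adjoin_le
    rintro g (⟨i, rfl⟩ | hg)
    · exact hXS i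
    · obtain ⟨i, hi⟩ := hg
      have : g = star (X i) := by rw [hi, star_star]
      rw [this]
      fin_cases i
      · exact hs0
      · exact hs1
  change (S : Set C(K, ℂ)) = Set.univ
  rw [Set.eq_univ_iff_forall]
  intro g
  have hg : g ∈ A.topologicalClosure := hA ▸ StarSubalgebra.mem_top
  exact closure_minimal (s := (A : Set C(K, ℂ))) hAS hS hg
end
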